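/- Let R be a Prüfer domain of finite Krull dimension d, let f ∈ R[Y] be nonzero, let A = R[Y][f^{-1}] be the localization of R[Y] away from f, and let P be a finitely generated projective A-module of constant rank r ≥ max{2, d+1}. Then E(A ⊕ P) acts transitively on Um(A ⊕ P); in particular P is cancellative. -/

import Mathlib

open Polynomial

/-- An element `m` of an `A`-module `M` is unimodular if some linear functional sends it to `1`. -/
def IsUnimodular (A : Type*) [CommRing A] (M : Type*) [AddCommGroup M] [Module A M]
    (m : M) : Prop :=
  ∃ φ : M →ₗ[A] A, φ m = 1

/-- `E(M)`: the subgroup of `Aut_A(M)` generated by transvections, i.e. automorphisms of the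
form `q ↦ q + φ(q) • p` with `φ(p) = 0` and `p` unimodular or `φ` unimodular. -/
def TransvectionGroup (A : Type*) [CommRing A] (M : Type*) [AddCommGroup M] [Module A M] :
    Subgroup (M ≃ₗ[A] M) :=
  Subgroup.closure {σ : M ≃ₗ[A] M | ∃ (p : M) (φ : M →ₗ[A] A), φ p = 0 ∧
    (IsUnimodular A M p ∨ IsUnimodular A (M →ₗ[A] A) φ) ∧ ∀ q : M, σ q = q + φ q • p}

/-- A projective module has constant rank `r` if its localization at every prime is free of
rank `r`. -/
def HasConstantRank (A : Type*) [CommRing A] (P : Type*) [AddCommGroup P] [Module A P]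
    (r : ℕ) : Prop :=
  ∀ (𝔭 : Ideal A) (h𝔭 : 𝔭.IsPrime),
    haveI := h𝔭
    Module.Free (Localization.AtPrime 𝔭) (LocalizedModule 𝔭.primeCompl P) ∧
    Module.finrank (Localization.AtPrime 𝔭) (LocalizedModule 𝔭.primeCompl P) = r

/-- Property `Ω(R)` for a projective module `P` over an `R`-algebra `S`. -/
def PropertyOmega (R : Type*) [CommRing R] (S : Type*) [CommRing S] [Algebra R S]
    (P : Type*) [AddCommGroup P] [Module S P] : Prop :=
  ∀ I : Ideal R, ∃ t : R,
    Ideal.Quotient.mk I t ∈ nonZeroDivisors (R ⧸ I) ∧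
    Module.Free
      (Localization (Submonoid.powers
        (Ideal.Quotient.mk (I.map (algebraMap R S)) (algebraMap R S t))))
      (LocalizedModule (Submonoid.powers
        (Ideal.Quotient.mk (I.map (algebraMap R S)) (algebraMap R S t)))
        (P ⧸ ((I.map (algebraMap R S)) • ⊤ : Submodule S P)))

section Development

section P1

theorem exists_mul_mem_minimal {B : Type*} [CommRing B] {I q : Ideal B} (hq : q ∈ I.minimalPrimes)
    {x : B} (hx : x ∈ q) : ∃ y, y ∉ q ∧ ∃ k : ℕ, x ^ k * y ∈ I := by
  have hqp : q.IsPrime := hq.1.1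
  by_contra hcon
  push Not at hcon
  have hd : Disjoint (I : Set B) (q.primeCompl ⊔ Submonoid.powers x : Submonoid B) := by
    rw [Set.disjoint_left]
    intro z hz hz'
    obtain ⟨σ, hσ, w, ⟨k, rfl⟩, rfl⟩ := Submonoid.mem_sup.1 hz'
    exact hcon σ hσ k (by rw [mul_comm]; exact hz)
  obtain ⟨p, hp, hJp, hpd⟩ := Ideal.exists_le_prime_disjoint I _ hd
  have hpq : p ≤ q := by
    intro z hz
    by_contra hzq
    exact Set.disjoint_left.1 hpd hz ((le_sup_left : q.primeCompl ≤ _) hzq)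
  have hqp' : q ≤ p := hq.2 ⟨hp, hJp⟩ hpq
  exact Set.disjoint_left.1 hpd (hqp' hx)
    ((le_sup_right : _ ≤ q.primeCompl ⊔ Submonoid.powers x) (Submonoid.mem_powers x))

/-- Kronecker-type lemma without noetherian hypotheses: `g` is a rank function on the set of primes
containing `I` and disjoint from `S`. -/
theorem kronecker_aux {B : Type*} [CommRing B] (S : Submonoid B) (a : B) {ι : Type*} [DecidableEq ι]
    (f : ι → B) (T : Finset ι) :
    ∀ (I : Ideal B) (g : Ideal B → ℕ),
      (∀ p q : Ideal B, p.IsPrime → q.IsPrime → I ≤ q → Disjoint (p : Set B) S →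
        q < p → g q < g p) →
      (∀ p : Ideal B, p.IsPrime → I ≤ p → Disjoint (p : Set B) S → g p < T.card) →
      ∃ l : ι → B, ∀ p : Ideal B, p.IsPrime → I ≤ p → Disjoint (p : Set B) S →
        (∀ i ∈ T, f i + l i * a ∈ p) → a ∈ p := by
  induction T using Finset.induction_on with
  | empty =>
    intro I g _ h
    refine ⟨fun _ => 0, fun p hp hI hS _ => ?_⟩
    have := h p hp hI hS
    simp at this
  | insert j T hj ih =>
    intro I g hmono hlt
    set x := f j with hx
    let N : Ideal B := I ⊔ Ideal.span {x} ⊔ (I.radical.colon (Ideal.span {x} : Set B))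
    have hIN : I ≤ N := le_sup_left.trans le_sup_left
    have hxN : x ∈ N := (le_sup_right.trans le_sup_left : Ideal.span {x} ≤ N)
      (Ideal.mem_span_singleton_self x)
    have hyN : ∀ y, y * x ∈ I.radical → y ∈ N := by
      intro y hy
      refine (le_sup_right : _ ≤ N) ?_
      rw [Submodule.mem_colon]
      intro z hz
      obtain ⟨w, rfl⟩ := Ideal.mem_span_singleton'.1 hz
      have := Ideal.mul_mem_left _ w hy
      simpa [mul_assoc, mul_comm, mul_left_comm] using this
    have hpos : ∀ p : Ideal B, p.IsPrime → N ≤ p → Disjoint (p : Set B) S → 0 < g p := by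
      intro p hp hN hS
      obtain ⟨q, hq, hqp⟩ := Ideal.exists_minimalPrimes_le (hIN.trans hN)
      have hqprime : q.IsPrime := hq.1.1
      rcases eq_or_lt_of_le hqp with rfl | hlt'
      · exfalso
        obtain ⟨y, hy, k, hk⟩ := exists_mul_mem_minimal hq (hN hxN)
        apply hy
        apply hN
        apply hyN
        refine ⟨k + 1, ?_⟩
        have : (y * x) ^ (k + 1) = (y ^ k * x) * (x ^ k * y) := by ring
        rw [this]
        exact Ideal.mul_mem_left _ _ hk
      · exact lt_of_le_of_lt (Nat.zero_le _) (hmono p q hp hqprime hq.1.2 hS hlt')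
    obtain ⟨l, hl⟩ := ih N (fun p => g p - 1)
      (by
        intro p q hp hq hN hS hqp
        have h1 := hmono p q hp hq (hIN.trans hN) hS hqp
        have h2 := hpos q hq hN (hS.mono_left (by exact_mod_cast hqp.le))
        show g q - 1 < g p - 1
        omega)
      (by
        intro p hp hN hS
        have h1 := hlt p hp (hIN.trans hN) hS
        have h2 := hpos p hp hN hS
        rw [Finset.card_insert_of_notMem hj] at h1
        show g p - 1 < _
        omega)
    -- get an explicit y
    let J : Ideal B := N ⊔ Ideal.span ((fun i => f i + l i * a) '' T)
    have key : ∃ σ ∈ S, ∃ k : ℕ, σ * a ^ k ∈ J := by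
      by_contra hcon
      push Not at hcon
      have hd : Disjoint (J : Set B) (S ⊔ Submonoid.powers a : Submonoid B) := by
        rw [Set.disjoint_left]
        intro z hz hz'
        obtain ⟨σ, hσ, w, ⟨k, rfl⟩, rfl⟩ := Submonoid.mem_sup.1 hz'
        exact hcon σ hσ k hz
      obtain ⟨p, hp, hJp, hpd⟩ := Ideal.exists_le_prime_disjoint J _ hd
      have hdS : Disjoint (p : Set B) S := hpd.mono_right (by
        exact_mod_cast (le_sup_left : S ≤ S ⊔ Submonoid.powers a))
      have := hl p hp (le_sup_left.trans hJp) hdS (fun i hi => hJp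
        ((le_sup_right : _ ≤ J) (Ideal.subset_span ⟨i, hi, rfl⟩)))
      exact Set.disjoint_left.1 hpd this
        ((le_sup_right : _ ≤ S ⊔ Submonoid.powers a) (Submonoid.mem_powers a))
    obtain ⟨σ, hσ, k, hk⟩ := key
    obtain ⟨n, hn, e, he, hne⟩ := Submodule.mem_sup.1 hk
    obtain ⟨n', hn', y, hy, hny⟩ := Submodule.mem_sup.1 hn
    have hyx : y * x ∈ I.radical := by
      have := (Submodule.mem_colon.1 hy) x (Ideal.mem_span_singleton_self x)
      simpa using this
    refine ⟨Function.update l j y, fun p hp hI hS h => ?_⟩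
    have hj' : x + y * a ∈ p := by
      have := h j (Finset.mem_insert_self _ _)
      simpa using this
    have hT : ∀ i ∈ T, f i + l i * a ∈ p := by
      intro i hi
      have hij : i ≠ j := fun h => hj (h ▸ hi)
      have := h i (Finset.mem_insert_of_mem hi)
      simpa [Function.update_of_ne hij] using this
    by_contra ha
    have hyxp : y * x ∈ p := (hp.radical_le_iff.2 hI) hyx
    have hxy : x ∈ p ∧ y ∈ p := by
      rcases hp.mem_or_mem hyxp with h1 | h1
      · refine ⟨?_, h1⟩
        have := p.sub_mem hj' (p.mul_mem_right a h1)
        simpa using this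
      · refine ⟨h1, ?_⟩
        have := p.sub_mem hj' h1
        have h2 : y * a ∈ p := by simpa using this
        exact (hp.mem_or_mem h2).resolve_right ha
    have hmem : σ * a ^ k ∈ p := by
      rw [← hne, ← hny]
      refine p.add_mem (p.add_mem ?_ hxy.2) ?_
      · exact (sup_le hI ((Ideal.span_singleton_le_iff_mem _).2 hxy.1)) hn'
      · refine (Ideal.span_le.2 ?_ : Ideal.span _ ≤ p) he
        rintro _ ⟨i, hi, rfl⟩
        exact hT i hi
    rcases hp.mem_or_mem hmem with h1 | h1
    · exact Set.disjoint_left.1 hS h1 hσ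
    · exact ha (hp.mem_of_pow_mem _ h1)

end P1

section P2
open Polynomial

def IsPrufer (R : Type*) [CommRing R] [IsDomain R] : Prop :=
  ∀ I : Ideal R, I ≠ ⊥ → I.FG →
      ∃ J : FractionalIdeal (nonZeroDivisors R) (FractionRing R),
        (I : FractionalIdeal (nonZeroDivisors R) (FractionRing R)) * J = 1

theorem exists_ht (R : Type*) [CommRing R] (d : ℕ) (hdim : ringKrullDim R = d) :
    ∃ ht : Ideal R → ℕ, (∀ p q : Ideal R, p.IsPrime → q.IsPrime → p < q → ht p < ht q) ∧
      ∀ p : Ideal R, p.IsPrime → ht p ≤ d := by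
  classical
  have hle : ∀ p : PrimeSpectrum R, Order.height p ≤ (d : ℕ∞) := by
    intro p
    have := Order.height_le_krullDim p
    rw [show Order.krullDim (PrimeSpectrum R) = (d : WithBot ℕ∞) from hdim] at this
    exact_mod_cast this
  refine ⟨fun p => if hp : p.IsPrime then (Order.height (⟨p, hp⟩ : PrimeSpectrum R)).toNat else 0,
    ?_, ?_⟩
  · intro p q hp hq hpq
    simp only [hp, hq, dif_pos]
    have h1 : Order.height (⟨p, hp⟩ : PrimeSpectrum R) < Order.height (⟨q, hq⟩ : PrimeSpectrum R) := by
      refine Order.height_strictMono (show (⟨p, hp⟩ : PrimeSpectrum R) < ⟨q, hq⟩ from hpq) ?_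
      exact lt_of_le_of_lt (hle _) (ENat.natCast_lt_top d)
    have hp' := (lt_of_le_of_lt (hle ⟨p, hp⟩) (ENat.natCast_lt_top d)).ne
    have hq' := (lt_of_le_of_lt (hle ⟨q, hq⟩) (ENat.natCast_lt_top d)).ne
    rw [← ENat.coe_toNat hp', ← ENat.coe_toNat hq'] at h1
    exact_mod_cast h1
  · intro p hp
    simp only [hp, dif_pos]
    exact ENat.toNat_le_of_le_natCast (hle _)

theorem prufer_poly {R : Type*} [CommRing R] [IsDomain R] (hP : IsPrufer R) (q : R[X]) (hq : q ≠ 0)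
    (m : Ideal R) (hm : m.IsPrime) :
    ∃ i, ∃ w : R[X], q.coeff i ≠ 0 ∧ C (q.coeff i) * w = C (w.coeff i) * q ∧ w.coeff i ∉ m := by
  classical
  let I : Ideal R := Ideal.span (q.support.image q.coeff : Set R)
  have hI : I ≠ ⊥ := by
    intro h
    have : q.leadingCoeff ∈ I := Ideal.subset_span (by
      simp only [Finset.coe_image, Set.mem_image, Finset.mem_coe]
      exact ⟨q.natDegree, by simpa using hq, rfl⟩)
    rw [h] at this
    exact hq (by simpa using this)
  obtain ⟨J, hJ⟩ := hP I hI ⟨_, rfl⟩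
  have hcoef : ∀ k, q.coeff k ∈ I := by
    intro k
    by_cases hk : k ∈ q.support
    · exact Ideal.subset_span (by
        simp only [Finset.coe_image, Set.mem_image, Finset.mem_coe]
        exact ⟨k, hk, rfl⟩)
    · rw [notMem_support_iff.1 hk]; exact I.zero_mem
  have hintgr : ∀ j ∈ J, ∀ k, ∃ c : R, algebraMap R (FractionRing R) c =
      algebraMap R (FractionRing R) (q.coeff k) * j := by
    intro j hj k
    have : algebraMap R (FractionRing R) (q.coeff k) * j ∈
        (I : FractionalIdeal (nonZeroDivisors R) (FractionRing R)) * J :=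
      FractionalIdeal.mul_mem_mul (FractionalIdeal.mem_coeIdeal_of_mem _ (hcoef k)) hj
    rw [hJ, FractionalIdeal.mem_one_iff] at this
    exact this
  have hex : ∃ j ∈ J, ∃ i, ∃ c : R, c ∉ m ∧ algebraMap R (FractionRing R) c =
      algebraMap R (FractionRing R) (q.coeff i) * j := by
    by_contra hcon
    push Not at hcon
    have hle : (I : FractionalIdeal (nonZeroDivisors R) (FractionRing R)) * J ≤
        (m : FractionalIdeal (nonZeroDivisors R) (FractionRing R)) := by
      rw [FractionalIdeal.mul_le]
      intro x hx j hj
      rw [FractionalIdeal.mem_coeIdeal] at hx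
      obtain ⟨x, hx, rfl⟩ := hx
      induction hx using Submodule.span_induction with
      | mem x hx =>
        simp only [Finset.coe_image, Set.mem_image, Finset.mem_coe] at hx
        obtain ⟨k, -, rfl⟩ := hx
        obtain ⟨c, hc⟩ := hintgr j hj k
        rw [← hc]
        refine FractionalIdeal.mem_coeIdeal_of_mem _ ?_
        by_contra hcm
        exact hcon j hj k c hcm hc
      | zero => simp
      | add x y _ _ h1 h2 =>
        rw [map_add, add_mul]
        exact Submodule.add_mem _ h1 h2
      | smul a x _ h =>
        rw [smul_eq_mul, map_mul, mul_assoc, ← Algebra.smul_def]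
        exact Submodule.smul_mem _ a h
    rw [hJ] at hle
    have h1 : (1 : FractionRing R) ∈ (m : FractionalIdeal (nonZeroDivisors R) (FractionRing R)) :=
      hle (FractionalIdeal.one_mem_one _)
    rw [FractionalIdeal.mem_coeIdeal] at h1
    obtain ⟨x, hx, h⟩ := h1
    have : x = 1 := (FaithfulSMul.algebraMap_injective R (FractionRing R)) (by simpa using h)
    exact hm.ne_top ((Ideal.eq_top_iff_one _).2 (this ▸ hx))
  obtain ⟨j, hj, i, c, hc, hcj⟩ := hex
  choose e he using hintgr j hj
  have hinj := (FaithfulSMul.algebraMap_injective R (FractionRing R))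
  have hec : e i = c := hinj (by rw [he, hcj])
  let w : R[X] := ∑ k ∈ q.support, monomial k (e k)
  have hw : ∀ k, w.coeff k = e k := by
    intro k
    simp only [w, finsetSum_coeff, coeff_monomial]
    rw [Finset.sum_ite_eq' q.support k e]
    split_ifs with hk
    · rfl
    · refine hinj ?_
      rw [he, notMem_support_iff.1 hk]; simp
  refine ⟨i, w, ?_, ?_, ?_⟩
  · intro h0
    rw [h0] at hcj
    have : c = 0 := hinj (by simpa using hcj)
    exact hc (this ▸ m.zero_mem)
  · ext k
    rw [coeff_C_mul, coeff_C_mul, hw, hw]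
    refine hinj ?_
    rw [map_mul, map_mul, he, he]
    ring
  · rw [hw, hec]; exact hc

def ExtP {R : Type*} [CommRing R] (Q : Ideal R[X]) : Prop := ∀ q ∈ Q, ∀ k, C (q.coeff k) ∈ Q

theorem extP_mono {R : Type*} [CommRing R] [IsDomain R] (hP : IsPrufer R) {Q Q' : Ideal R[X]}
    (hQ : Q.IsPrime) (hQ' : Q'.IsPrime) (hle : Q ≤ Q') (h : ExtP Q') : ExtP Q := by
  classical
  by_contra hcon
  simp only [ExtP, not_forall] at hcon
  obtain ⟨q, hq, k, hk⟩ := hcon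
  let q' : R[X] := ∑ k ∈ q.support with C (q.coeff k) ∉ Q, monomial k (q.coeff k)
  have hcoef : ∀ k, q'.coeff k = if C (q.coeff k) ∉ Q then q.coeff k else 0 := by
    intro k
    simp only [q', finsetSum_coeff, coeff_monomial]
    rw [Finset.sum_ite_eq']
    by_cases h1 : k ∈ q.support
    · simp [h1] at *
    · have : q.coeff k = 0 := notMem_support_iff.1 h1
      simp [this]
  have hdiff : q - q' ∈ Q := by
    rw [(q - q').as_sum_support_C_mul_X_pow]
    refine Ideal.sum_mem _ fun i _ => Ideal.mul_mem_right _ _ ?_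
    rw [coeff_sub, hcoef]
    by_cases h1 : C (q.coeff i) ∈ Q
    · rw [if_neg (by simpa using h1)]; simpa using h1
    · rw [if_pos h1]; simp
  have hq'Q : q' ∈ Q := by
    have := Q.sub_mem hq hdiff
    simpa using this
  have hq'0 : q' ≠ 0 := by
    intro h0
    have := hcoef k
    rw [h0, if_pos hk] at this
    rw [← this] at hk
    simp at hk
  obtain ⟨i, w, hi, hw, hwm⟩ := prufer_poly hP q' hq'0 (Q'.comap C) (hQ'.comap C)
  have hiQ : C (q'.coeff i) ∉ Q := by
    rw [hcoef] at hi ⊢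
    by_cases h1 : C (q.coeff i) ∈ Q
    · rw [if_neg (by simpa using h1)] at hi; simp at hi
    · rw [if_pos h1]; exact h1
  have : C (q'.coeff i) * w ∈ Q := by rw [hw]; exact Ideal.mul_mem_left _ _ hq'Q
  have hwQ := (hQ.mem_or_mem this).resolve_left hiQ
  exact hwm (h w (hle hwQ) i)

theorem extP_of_lt {R : Type*} [CommRing R] {Q Q' : Ideal R[X]}
    (hQ : Q.IsPrime) (hlt : Q < Q') (h : Q.comap C = Q'.comap C) : ExtP Q := by
  by_contra hcon
  simp only [ExtP, not_forall] at hcon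
  obtain ⟨q, hq, k, hk⟩ := hcon
  obtain ⟨r, hr', hr⟩ := SetLike.exists_of_lt hlt
  let p : Ideal R := Q.comap C
  have hp : p.IsPrime := hQ.comap C
  let j : R ⧸ p →+* R[X] ⧸ Q := Ideal.quotientMap Q C le_rfl
  let _ : Algebra (R ⧸ p) (R[X] ⧸ Q) := j.toAlgebra
  have hjC : ∀ x, algebraMap (R ⧸ p) (R[X] ⧸ Q) (Ideal.Quotient.mk p x) = Ideal.Quotient.mk Q (C x) :=
    fun x => rfl
  have hX : IsAlgebraic (R ⧸ p) (Ideal.Quotient.mk Q X) := by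
    refine ⟨q.map (Ideal.Quotient.mk p), ?_, ?_⟩
    · intro h0
      have := congrArg (fun t => t.coeff k) h0
      simp only [coeff_map, coeff_zero] at this
      exact hk (show q.coeff k ∈ p from Ideal.Quotient.eq_zero_iff_mem.1 this)
    · have h1 : ∀ t : R[X], aeval (Ideal.Quotient.mk Q X) (t.map (Ideal.Quotient.mk p)) =
          Ideal.Quotient.mk Q t := by
        intro t
        rw [aeval_def, eval₂_map]
        have : (algebraMap (R ⧸ p) (R[X] ⧸ Q)).comp (Ideal.Quotient.mk p) =
          (Ideal.Quotient.mk Q).comp C := rfl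
        rw [this, ← hom_eval₂]
        simp
      rw [h1]
      exact Ideal.Quotient.eq_zero_iff_mem.2 hq
  have hall : ∀ t : R[X], IsAlgebraic (R ⧸ p) (Ideal.Quotient.mk Q t) := by
    intro t
    induction t using Polynomial.induction_on' with
    | add a b ha hb => rw [map_add]; exact ha.add hb
    | monomial n a =>
      rw [← C_mul_X_pow_eq_monomial, map_mul, map_pow]
      exact ((hjC a) ▸ isAlgebraic_algebraMap _).mul (hX.pow n)
  obtain ⟨u, hu, hur⟩ := hall r
  obtain ⟨v, rfl⟩ := Polynomial.map_surjective (Ideal.Quotient.mk p) Ideal.Quotient.mk_surjective u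
  have := Ideal.comap_lt_comap_of_root_mem_sdiff (f := (C : R →+* R[X])) hlt.le (r := r) ⟨hr', hr⟩ hu (by
    rw [aeval_def, eval₂_map] at hur
    have h2 : (algebraMap (R ⧸ p) (R[X] ⧸ Q)).comp (Ideal.Quotient.mk p) =
          (Ideal.Quotient.mk Q).comp C := rfl
    rw [h2, ← hom_eval₂] at hur
    exact Ideal.Quotient.eq_zero_iff_mem.1 hur)
  exact this.ne h

open Classical in
/-- rank function on primes of `R[X]`. -/
noncomputable def polyRank {R : Type*} [CommRing R] (ht : Ideal R → ℕ) (Q : Ideal R[X]) : ℕ :=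
  ht (Q.comap C) + if ExtP Q then 0 else 1

theorem polyRank_lt {R : Type*} [CommRing R] [IsDomain R] (hP : IsPrufer R) (ht : Ideal R → ℕ)
    (h1 : ∀ p q : Ideal R, p.IsPrime → q.IsPrime → p < q → ht p < ht q) {Q Q' : Ideal R[X]}
    (hQ : Q.IsPrime) (hQ' : Q'.IsPrime) (hlt : Q < Q') : polyRank ht Q < polyRank ht Q' := by
  unfold polyRank
  rcases eq_or_lt_of_le (Ideal.comap_mono (f := (C : R →+* R[X])) hlt.le) with h | h
  · have hE := extP_of_lt hQ hlt h
    have hE' : ¬ ExtP Q' := by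
      intro hE'
      refine hlt.not_ge fun q hq => ?_
      rw [q.as_sum_support_C_mul_X_pow]
      refine Ideal.sum_mem _ fun i _ => Ideal.mul_mem_right _ _ ?_
      have : q.coeff i ∈ Q'.comap C := hE' q hq i
      rw [← h] at this
      exact this
    rw [h, if_pos hE, if_neg hE']
    omega
  · have := h1 _ _ (hQ.comap C) (hQ'.comap C) h
    by_cases hE : ExtP Q
    · rw [if_pos hE]; split_ifs <;> omega
    · rw [if_neg hE, if_neg (fun h => hE (extP_mono hP hQ hQ' hlt.le h))]
      omega

theorem comap_lt_of_loc {B A : Type*} [CommRing B] [CommRing A] [Algebra B A] (M : Submonoid B)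
    [IsLocalization M A] {q q' : Ideal A} (h : q < q') :
    q.comap (algebraMap B A) < q'.comap (algebraMap B A) := by
  refine lt_of_le_of_ne (Ideal.comap_mono h.le) fun he => h.ne ?_
  rw [← IsLocalization.map_under M A q, ← IsLocalization.map_under M A q']
  exact congrArg _ he

/-- rank function on primes of `A` containing a nonzero constant `s`. -/
theorem exists_rank_s {R A : Type*} [CommRing R] [IsDomain R] (hP : IsPrufer R) (d : ℕ)
    (hdim : ringKrullDim R = d) [CommRing A] [Algebra R[X] A] (f : R[X]) [IsLocalization.Away f A] :
    ∃ G : Ideal A → ℕ, ∀ s : R, s ≠ 0 →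
      (∀ p q : Ideal A, p.IsPrime → q.IsPrime → algebraMap R[X] A (C s) ∈ q → q < p → G q < G p) ∧
      (∀ p : Ideal A, p.IsPrime → algebraMap R[X] A (C s) ∈ p → G p < d + 1) := by
  obtain ⟨ht, h1, h2⟩ := exists_ht R d hdim
  have hpos : ∀ s : R, s ≠ 0 → ∀ p : Ideal A, p.IsPrime → algebraMap R[X] A (C s) ∈ p →
      0 < polyRank ht (p.comap (algebraMap R[X] A)) := by
    intro s hs p hp hsp
    have : ht ⊥ < ht ((p.comap (algebraMap R[X] A)).comap C) := by
      refine h1 _ _ Ideal.isPrime_bot ((hp.comap _).comap _) (bot_lt_iff_ne_bot.2 fun h => hs ?_)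
      have : s ∈ (p.comap (algebraMap R[X] A)).comap C := hsp
      rw [h] at this
      simpa using this
    unfold polyRank
    omega
  refine ⟨fun q => polyRank ht (q.comap (algebraMap R[X] A)) - 1, fun s hs => ⟨?_, ?_⟩⟩
  · intro p q hp hq hsq hqp
    have := polyRank_lt hP ht h1 (hq.comap (algebraMap R[X] A)) (hp.comap (algebraMap R[X] A))
      (comap_lt_of_loc (Submonoid.powers f) hqp)
    have := hpos s hs q hq hsq
    show _ - 1 < _ - 1
    omega
  · intro p hp hsp
    have := h2 _ ((hp.comap (algebraMap R[X] A)).comap C)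
    show _ - 1 < _
    unfold polyRank
    split_ifs <;> omega

/-- K1 -/
theorem kron_s {R A : Type*} [CommRing R] [IsDomain R] (hP : IsPrufer R) (d : ℕ)
    (hdim : ringKrullDim R = d) [CommRing A] [Algebra R[X] A] (f : R[X]) [IsLocalization.Away f A]
    {ι : Type*} [DecidableEq ι] (T : Finset ι) (hT : d + 1 ≤ T.card) (s : R) (hs : s ≠ 0)
    (a : A) (g : ι → A) : ∃ l : ι → A, ∀ p : Ideal A, p.IsPrime → algebraMap R[X] A (C s) ∈ p →
      (∀ i ∈ T, g i + l i * a ∈ p) → a ∈ p := by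
  obtain ⟨G, hG⟩ := exists_rank_s (A := A) hP d hdim f
  obtain ⟨h1, h2⟩ := hG s hs
  obtain ⟨l, hl⟩ := kronecker_aux (⊥ : Submonoid A) a g T (Ideal.span {algebraMap R[X] A (C s)}) G
    (fun p q hp hq hI _ hlt => h1 p q hp hq (hI (Ideal.mem_span_singleton_self _)) hlt)
    (fun p hp hI _ => lt_of_lt_of_le (h2 p hp (hI (Ideal.mem_span_singleton_self _))) hT)
  refine ⟨l, fun p hp hsp h => hl p hp ((Ideal.span_singleton_le_iff_mem _).2 hsp) ?_ h⟩
  rw [Set.disjoint_left]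
  rintro x hx h1
  rw [SetLike.mem_coe, Submonoid.mem_bot] at h1
  exact hp.ne_top ((Ideal.eq_top_iff_one _).2 (h1 ▸ hx))

/-- K3 -/
theorem kron_R {R : Type*} [CommRing R] (d : ℕ)
    (hdim : ringKrullDim R = d) 
    {ι : Type*} [DecidableEq ι] (T : Finset ι) (hT : d + 1 ≤ T.card)
    (a : R) (g : ι → R) : ∃ l : ι → R, ∀ p : Ideal R, p.IsPrime → 
      (∀ i ∈ T, g i + l i * a ∈ p) → a ∈ p := by
  obtain ⟨ht, h1, h2⟩ := exists_ht R d hdim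
  obtain ⟨l, hl⟩ := kronecker_aux (⊥ : Submonoid R) a g T ⊥ ht
    (fun p q hp hq hI _ hlt => h1 q p hq hp hlt)
    (fun p hp hI _ => lt_of_lt_of_le (Nat.lt_succ_of_le (h2 p hp)) hT)
  refine ⟨l, fun p hp h => hl p hp bot_le ?_ h⟩
  rw [Set.disjoint_left]
  rintro x hx h1
  rw [SetLike.mem_coe, Submonoid.mem_bot] at h1
  exact hp.ne_top ((Ideal.eq_top_iff_one _).2 (h1 ▸ hx))

/-- The multiplicative set `s^N (1 + s x)`. -/
def sigmaSet {R : Type*} [CommRing R] (s : R) : Submonoid R where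
  carrier := {z | ∃ (N : ℕ) (x : R), z = s ^ N * (1 + s * x)}
  one_mem' := ⟨0, 0, by simp⟩
  mul_mem' := by
    rintro _ _ ⟨N, x, rfl⟩ ⟨M, y, rfl⟩
    exact ⟨N + M, x + y + s * x * y, by ring⟩

/-- K2 -/
theorem kron_h {R A : Type*} [CommRing R] [IsDomain R] (d : ℕ)
    (hdim : ringKrullDim R = d) [CommRing A] [Algebra R[X] A] (f : R[X]) [IsLocalization.Away f A]
    {ι : Type*} [DecidableEq ι] (T : Finset ι) (hT : d ≤ T.card) (s : R) (h : R[X])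
    (hh : h.leadingCoeff ∣ s)
    (a : A) (g : ι → A) : ∃ l : ι → A, ∀ p : Ideal A, p.IsPrime → algebraMap R[X] A h ∈ p →
      Disjoint (p : Set A) ((sigmaSet s).map ((algebraMap R[X] A).comp C)) →
      (∀ i ∈ T, g i + l i * a ∈ p) → a ∈ p := by
  obtain ⟨ht, h1, h2⟩ := exists_ht R d hdim
  have hsig : ∀ p : Ideal A, Disjoint (p : Set A) ((sigmaSet s).map ((algebraMap R[X] A).comp C)) →
      ∀ z ∈ sigmaSet s, z ∉ (p.comap (algebraMap R[X] A)).comap C := by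
    intro p hp z hz hzp
    exact Set.disjoint_left.1 hp (show (algebraMap R[X] A).comp C z ∈ (p : Set A) from hzp)
      (Submonoid.mem_map_of_mem _ hz)
  obtain ⟨l, hl⟩ := kronecker_aux ((sigmaSet s).map ((algebraMap R[X] A).comp C)) a g T
    (Ideal.span {algebraMap R[X] A h})
    (fun q => ht ((q.comap (algebraMap R[X] A)).comap C))
    (by
      intro p q hp hq hI hdis hlt
      have hlt' := comap_lt_of_loc (B := R[X]) (Submonoid.powers f) hlt
      refine h1 _ _ ((hq.comap _).comap _) ((hp.comap _).comap _)
        (lt_of_le_of_ne (Ideal.comap_mono hlt'.le) fun he => ?_)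
      have hE := extP_of_lt (hq.comap _) hlt' he
      have hlead := hE h (hI (Ideal.mem_span_singleton_self _)) h.natDegree
      have hs : s ∈ (q.comap (algebraMap R[X] A)).comap C := Ideal.mem_of_dvd _ hh hlead
      rw [he] at hs
      exact hsig p hdis s ⟨1, 0, by simp⟩ hs)
    (by
      intro p hp hI hdis
      set 𝔭 := (p.comap (algebraMap R[X] A)).comap C with h𝔭
      have hpp : 𝔭.IsPrime := (hp.comap _).comap _
      have hne : 𝔭 ⊔ Ideal.span {s} ≠ ⊤ := by
        intro htop
        rw [Ideal.eq_top_iff_one] at htop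
        obtain ⟨u, hu, v, hv, huv⟩ := Submodule.mem_sup.1 htop
        obtain ⟨x, rfl⟩ := Ideal.mem_span_singleton'.1 hv
        refine hsig p hdis u ⟨0, -x, ?_⟩ hu
        rw [← eq_sub_iff_add_eq] at huv
        rw [huv]; ring
      obtain ⟨m, hm, hle⟩ := Ideal.exists_le_maximal _ hne
      have hlt : 𝔭 < m := by
        refine lt_of_le_of_ne (le_sup_left.trans hle) fun he => ?_
        have : s ∈ m := hle ((le_sup_right : _ ≤ 𝔭 ⊔ Ideal.span {s}) (Ideal.mem_span_singleton_self _))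
        rw [← he] at this
        exact hsig p hdis s ⟨1, 0, by simp⟩ this
      have := h1 _ _ hpp hm.isPrime hlt
      have := h2 m hm.isPrime
      show ht 𝔭 < _
      omega)
  exact ⟨l, fun p hp hsp hd h => hl p hp ((Ideal.span_singleton_le_iff_mem _).2 hsp) hd h⟩

/-- K4 -/
theorem kron_m {R : Type*} [CommRing R] [IsDomain R] 
    {ι : Type*} [DecidableEq ι] (T : Finset ι) (hT : 1 ≤ T.card) (m : Ideal R) (hm : m.IsMaximal)
    (h : R[X]) (hh : h.leadingCoeff ∉ m)
    (a : R[X]) (g : ι → R[X]) : ∃ l : ι → R[X], ∀ p : Ideal R[X], p.IsPrime → h ∈ p →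
      m ≤ p.comap C → (∀ i ∈ T, g i + l i * a ∈ p) → a ∈ p := by
  obtain ⟨l, hl⟩ := kronecker_aux (⊥ : Submonoid R[X]) a g T (Ideal.span {h} ⊔ m.map C)
    (fun q => 0)
    (by
      intro p q hp hq hI _ hlt
      exfalso
      have h1 : ∀ q : Ideal R[X], q.IsPrime → Ideal.span {h} ⊔ m.map C ≤ q → q.comap C = m := by
        intro q hq hI
        refine (hm.eq_of_le (hq.comap C).ne_top ?_).symm
        exact Ideal.map_le_iff_le_comap.1 (le_sup_right.trans hI)
      have hE := extP_of_lt hq hlt ((h1 q hq hI).trans (h1 p hp (hI.trans hlt.le)).symm)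
      have : h.leadingCoeff ∈ q.comap C := hE h (hI ((le_sup_left : _ ≤ Ideal.span {h} ⊔ m.map C)
        (Ideal.mem_span_singleton_self _))) h.natDegree
      rw [h1 q hq hI] at this
      exact hh this)
    (fun p hp hI _ => hT)
  refine ⟨l, fun p hp hhp hmp h => hl p hp (sup_le ((Ideal.span_singleton_le_iff_mem _).2 hhp)
    (Ideal.map_le_iff_le_comap.2 hmp)) ?_ h⟩
  rw [Set.disjoint_left]
  rintro x hx h1
  rw [SetLike.mem_coe, Submonoid.mem_bot] at h1
  exact hp.ne_top ((Ideal.eq_top_iff_one _).2 (h1 ▸ hx))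

end P2

section P3
open Polynomial

/-- The elementary monoid with entries in `D`. -/
def Elem (n : Type*) [Fintype n] [DecidableEq n] {B : Type*} [CommRing B] (D : AddSubgroup B) :
    Submonoid (Matrix n n B) :=
  Submonoid.closure {M | ∃ i j x, i ≠ j ∧ x ∈ D ∧ M = Matrix.transvection i j x}

namespace Elem
open Matrix
variable {n : Type*} [Fintype n] [DecidableEq n] {B : Type*} [CommRing B] {D : AddSubgroup B}

theorem trans_mem {i j : n} (hij : i ≠ j) {x : B} (hx : x ∈ D) : transvection i j x ∈ Elem n D :=
  Submonoid.subset_closure ⟨i, j, x, hij, hx, rfl⟩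

theorem mono {D' : AddSubgroup B} (h : D ≤ D') : Elem n D ≤ Elem n D' := by
  refine Submonoid.closure_mono ?_
  rintro _ ⟨i, j, x, hij, hx, rfl⟩
  exact ⟨i, j, x, hij, h hx, rfl⟩

theorem exists_inv {M : Matrix n n B} (hM : M ∈ Elem n D) : ∃ N ∈ Elem n D, M * N = 1 ∧ N * M = 1 := by
  induction hM using Submonoid.closure_induction with
  | mem M h =>
    obtain ⟨i, j, x, hij, hx, rfl⟩ := h
    refine ⟨transvection i j (-x), trans_mem hij (D.neg_mem hx), ?_, ?_⟩
    · rw [transvection_mul_transvection_same _ _ hij]; simp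
    · rw [transvection_mul_transvection_same _ _ hij]; simp
  | one => exact ⟨1, one_mem _, by simp, by simp⟩
  | mul M M' _ _ h h' =>
    obtain ⟨N, hN, h1, h2⟩ := h
    obtain ⟨N', hN', h1', h2'⟩ := h'
    refine ⟨N' * N, mul_mem hN' hN, ?_, ?_⟩
    · rw [mul_assoc, ← mul_assoc M', h1', one_mul, h1]
    · rw [mul_assoc, ← mul_assoc N, h2, one_mul, h2']

theorem map_mem {B' : Type*} [CommRing B'] (φ : B →+* B') {D' : AddSubgroup B'}
    (h : ∀ x ∈ D, φ x ∈ D') {M : Matrix n n B} (hM : M ∈ Elem n D) : M.map φ ∈ Elem n D' := by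
  induction hM using Submonoid.closure_induction with
  | mem M h' =>
    obtain ⟨i, j, x, hij, hx, rfl⟩ := h'
    have : (transvection i j x).map φ = transvection i j (φ x) := by
      simp only [transvection]
      rw [Matrix.map_add φ (by simp)]
      simp 
    rw [this]
    exact trans_mem hij (h x hx)
  | one => rw [Matrix.map_one φ (by simp) (by simp)]; exact one_mem _
  | mul M M' _ _ h h' => rw [Matrix.map_mul]; exact mul_mem h h'

theorem lift_mem {B' : Type*} [CommRing B'] (φ : B →+* B')
    {M : Matrix n n B'} (hM : M ∈ Elem n (D.map φ.toAddMonoidHom)) :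
    ∃ T ∈ Elem n D, T.map φ = M := by
  induction hM using Submonoid.closure_induction with
  | mem M h' =>
    obtain ⟨i, j, x, hij, ⟨x, hx, rfl⟩, rfl⟩ := h'
    refine ⟨transvection i j x, trans_mem hij hx, ?_⟩
    simp only [transvection]
    rw [Matrix.map_add φ (by simp)]
    simp 
  | one => exact ⟨1, one_mem _, Matrix.map_one φ (by simp) (by simp)⟩
  | mul M M' _ _ h h' =>
    obtain ⟨T, hT, rfl⟩ := h
    obtain ⟨T', hT', rfl⟩ := h'
    exact ⟨T * T', mul_mem hT hT', by rw [Matrix.map_mul]⟩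

theorem outer_mul (u v u' v' : n → B) (h : v ⬝ᵥ u' = 0) :
    (1 + vecMulVec u v) * (1 + vecMulVec u' v') = 1 + (vecMulVec u v + vecMulVec u' v') := by
  rw [add_mul, mul_add, mul_add, vecMulVec_mul_vecMulVec, h]
  simp [add_assoc, add_comm]

theorem sum_left {κ : Type*} (T : Finset κ) (u : κ → n → B) (v : n → B)
    (h0 : ∀ i ∈ T, v ⬝ᵥ u i = 0) (h : ∀ i ∈ T, 1 + vecMulVec (u i) v ∈ Elem n D) :
    1 + vecMulVec (∑ i ∈ T, u i) v ∈ Elem n D := by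
  classical
  induction T using Finset.induction_on with
  | empty => rw [Finset.sum_empty, zero_vecMulVec, add_zero]; exact one_mem _
  | insert i T hi ih =>
    rw [Finset.sum_insert hi, add_vecMulVec, ← outer_mul]
    · exact mul_mem (h i (Finset.mem_insert_self _ _))
        (ih (fun j hj => h0 j (Finset.mem_insert_of_mem hj))
          (fun j hj => h j (Finset.mem_insert_of_mem hj)))
    · rw [dotProduct_sum]
      exact Finset.sum_eq_zero fun j hj => h0 j (Finset.mem_insert_of_mem hj)

theorem sum_right {κ : Type*} (T : Finset κ) (u : n → B) (v : κ → n → B)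
    (h0 : ∀ i ∈ T, v i ⬝ᵥ u = 0) (h : ∀ i ∈ T, 1 + vecMulVec u (v i) ∈ Elem n D) :
    1 + vecMulVec u (∑ i ∈ T, v i) ∈ Elem n D := by
  classical
  induction T using Finset.induction_on with
  | empty => rw [Finset.sum_empty, vecMulVec_zero, add_zero]; exact one_mem _
  | insert i T hi ih =>
    rw [Finset.sum_insert hi, vecMulVec_add, ← outer_mul]
    · exact mul_mem (h i (Finset.mem_insert_self _ _))
        (ih (fun j hj => h0 j (Finset.mem_insert_of_mem hj))
          (fun j hj => h j (Finset.mem_insert_of_mem hj)))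
    · exact h0 i (Finset.mem_insert_self _ _)

theorem outer_single (i k : n) (x y : B) :
    (1 + vecMulVec (Pi.single i x) (Pi.single k y) : Matrix n n B) = transvection i k (x * y) := by
  rw [transvection]
  congr 1
  ext a b
  simp only [vecMulVec_apply, single_apply, Pi.single_apply]
  by_cases h1 : i = a <;> by_cases h2 : k = b <;> simp [h1, h2, eq_comm]

theorem eq_sum_single (u : n → B) : u = ∑ i, Pi.single i (u i) := by
  ext j
  simp [Pi.single_apply]

theorem col_mem (u : n → B) (k : n) (hk : u k = 0) (hu : ∀ i, u i ∈ D) :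
    1 + vecMulVec u (Pi.single k 1) ∈ Elem n D := by
  rw [eq_sum_single u]
  refine sum_left _ _ _ ?_ ?_
  · intro i _
    by_cases hik : i = k
    · subst hik; simp [hk]
    · simp [hik]
  · intro i _
    by_cases hik : i = k
    · subst hik
      rw [hk]; simp
    · rw [outer_single]
      exact trans_mem hik (by simpa using hu i)

theorem row_mem (v : n → B) (k : n) (hk : v k = 0) (hu : ∀ i, v i ∈ D) :
    1 + vecMulVec (Pi.single k 1) v ∈ Elem n D := by
  rw [eq_sum_single v]
  refine sum_right _ _ _ ?_ ?_
  · intro i _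
    by_cases hik : i = k
    · subst hik; simp [hk]
    · simp [Ne.symm hik]
  · intro i _
    by_cases hik : i = k
    · subst hik
      rw [hk]; simp
    · rw [outer_single]
      exact trans_mem (Ne.symm hik) (by simpa using hu i)

theorem comm_mem (u v : n → B) (k : n) (hu : u k = 0) (hv : v k = 0) (huv : v ⬝ᵥ u = 0)
    (huD : ∀ i, u i ∈ D) (hvD : ∀ i, v i ∈ D) : 1 + vecMulVec u v ∈ Elem n D := by
  have h1 := col_mem u k hu huD
  have h2 := row_mem v k hv hvD
  have h3 := col_mem (-u) k (by simp [hu]) (fun i => D.neg_mem (huD i))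
  have h4 := row_mem (-v) k (by simp [hv]) (fun i => D.neg_mem (hvD i))
  have h := mul_mem (mul_mem (mul_mem h1 h2) h3) h4
  convert h using 1
  rw [neg_vecMulVec, vecMulVec_neg]
  set a := vecMulVec u (Pi.single k (1 : B)) with ha
  set b := vecMulVec (Pi.single k (1 : B)) v with hb
  have haa : a * a = 0 := by rw [ha, vecMulVec_mul_vecMulVec]; simp [hu]
  have hbb : b * b = 0 := by rw [hb, vecMulVec_mul_vecMulVec]; simp [hv]
  have hba : b * a = 0 := by rw [hb, ha, vecMulVec_mul_vecMulVec]; simp [huv]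
  have hab : a * b = vecMulVec u v := by rw [hb, ha, vecMulVec_mul_vecMulVec]; simp
  rw [← hab]
  have e1 : (1 + a) * (1 + b) * (1 + -a) * (1 + -b) = 1 + a * b - a * a - b * a - b * b + a * a * b
    - a * (b * a) - a * (b * b) + b * a * b + a * (b * a) * b := by noncomm_ring
  rw [e1, haa, hba, hbb]
  simp

theorem suslin (p φ ψ : n → B) (hψ : ψ ⬝ᵥ p = 1) (hφ : φ ⬝ᵥ p = 0) (θ₁ θ₂ : B)
    (hn : ∀ i j : n, ∃ k, k ≠ i ∧ k ≠ j)
    (h1 : ∀ i, θ₁ * p i ∈ D) (h2 : ∀ i j k, θ₂ * (ψ i * φ j * p k) ∈ D)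
    (h3 : ∀ i j k l, θ₁ * θ₂ * (ψ i * φ j * p k * p l) ∈ D) :
    1 + vecMulVec ((θ₁ * θ₂) • p) φ ∈ Elem n D := by
  let ω : n × n → n → B := fun x => (ψ x.1 * φ x.2) • (Pi.single x.2 (p x.1) - Pi.single x.1 (p x.2))
  have hω : φ = ∑ x, ω x := by
    ext k
    simp only [ω, Fintype.sum_prod_type, Finset.sum_apply, Pi.smul_apply, Pi.sub_apply, smul_eq_mul,
      mul_sub, Finset.sum_sub_distrib, Pi.single_apply, mul_ite, mul_zero]
    have e1 : ∀ i, (∑ j, if k = j then ψ i * φ j * p i else 0) = ψ i * φ k * p i := by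
      intro i; simp
    have e2 : (∑ i, ∑ j, if k = i then ψ i * φ j * p j else 0) = ψ k * ∑ j, φ j * p j := by
      rw [Finset.sum_comm, Finset.mul_sum]
      refine Finset.sum_congr rfl fun j _ => ?_
      simp [mul_assoc]
    have e3 : (∑ i, ψ i * φ k * p i) = φ k * ∑ i, ψ i * p i := by
      rw [Finset.mul_sum]
      refine Finset.sum_congr rfl fun j _ => by ring
    simp only [e1, e2, e3]
    rw [show ∑ i, ψ i * p i = 1 from hψ, show ∑ i, φ i * p i = 0 from hφ]
    simp
  have hωp : ∀ x, ω x ⬝ᵥ p = 0 := by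
    intro x
    simp only [ω, smul_dotProduct, sub_dotProduct, single_dotProduct, smul_eq_mul]
    ring
  rw [hω]
  refine sum_right _ _ _ (fun x _ => by rw [dotProduct_smul, hωp, smul_zero]) ?_
  rintro ⟨i, j⟩ -
  by_cases hij : i = j
  · have : ω (i, j) = 0 := by simp [ω, hij]
    rw [this, vecMulVec_zero, add_zero]; exact one_mem _
  obtain ⟨k, hki, hkj⟩ := hn i j
  let q : n → B := fun l => if l = i ∨ l = j then p l else 0
  let q' : n → B := fun l => if l = i ∨ l = j then 0 else p l
  have hqq : p = q' + q := by
    ext l; simp only [q, q', Pi.add_apply]; split_ifs <;> simp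
  have hωi : ω (i, j) = (ψ i * φ j) • (Pi.single j (p i) - Pi.single i (p j)) := rfl
  have hωq : ω (i, j) ⬝ᵥ q = 0 := by
    simp only [hωi, smul_dotProduct, sub_dotProduct, single_dotProduct, smul_eq_mul, q]
    simp; ring
  have e : vecMulVec ((θ₁ * θ₂) • p) (ω (i, j)) = vecMulVec ((θ₁ * θ₂) • q') (ω (i, j)) +
      vecMulVec ((θ₁ * θ₂) • q) (ω (i, j)) := by
    rw [← add_vecMulVec, ← smul_add, ← hqq]
  rw [e, ← outer_mul _ _ _ _ (by rw [dotProduct_smul, hωq, smul_zero])]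
  refine mul_mem ?_ ?_
  · have e' : vecMulVec ((θ₁ * θ₂) • q') (ω (i, j)) =
        vecMulVec ((θ₁ * θ₂ * (ψ i * φ j * p i)) • q') (Pi.single j 1) +
        vecMulVec ((- (θ₁ * θ₂ * (ψ i * φ j * p j))) • q') (Pi.single i 1) := by
      ext a b
      simp only [Matrix.add_apply, vecMulVec_apply, hωi, Pi.smul_apply, Pi.sub_apply, smul_eq_mul,
        Pi.single_apply]
      split_ifs <;> ring
    rw [e', ← outer_mul _ _ _ _ (by simp [q'])]
    refine mul_mem (col_mem _ _ (by simp [q']) ?_) (col_mem _ _ (by simp [q']) ?_)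
    · intro l
      simp only [q', Pi.smul_apply, smul_eq_mul]
      split_ifs
      · simp
      · rw [mul_assoc]; exact h3 i j i l
    · intro l
      simp only [q', Pi.smul_apply, smul_eq_mul]
      split_ifs
      · simp
      · rw [neg_mul, mul_assoc]; exact D.neg_mem (h3 i j j l)
  · have e' : vecMulVec ((θ₁ * θ₂) • q) (ω (i, j)) = vecMulVec (θ₁ • q) (θ₂ • ω (i, j)) := by
      ext a b
      simp only [vecMulVec_apply, Pi.smul_apply, smul_eq_mul]
      ring
    rw [e']
    refine comm_mem _ _ k (by simp [q, hki, hkj]) (by simp [hωi, hki, hkj]) ?_ ?_ ?_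
    · rw [dotProduct_smul, smul_dotProduct, hωq]; simp
    · intro l
      simp only [q, Pi.smul_apply, smul_eq_mul]
      split_ifs
      · exact h1 l
      · simp
    · intro l
      simp only [hωi, Pi.smul_apply, smul_eq_mul, Pi.sub_apply, Pi.single_apply]
      rw [mul_sub, mul_sub]
      refine D.sub_mem ?_ ?_
      · split_ifs
        · exact h2 i j i
        · simp
      · split_ifs
        · exact h2 i j j
        · simp

end Elem

end P3

section P3b
open Polynomial Matrix

/-- multiples of `s` as additive subgroup -/
def Ds {B : Type*} [CommRing B] (s : B) : AddSubgroup B := (Ideal.span {s}).toAddSubgroup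

theorem mem_Ds {B : Type*} [CommRing B] {s x : B} : x ∈ Ds s ↔ ∃ z, x = s * z := by
  unfold Ds
  rw [Submodule.mem_toAddSubgroup, Ideal.mem_span_singleton]
  rfl

theorem map_Ds {B B' : Type*} [CommRing B] [CommRing B'] (φ : B →+* B') (s : B) :
    ∀ x ∈ Ds s, φ x ∈ Ds (φ s) := by
  intro x hx
  obtain ⟨z, rfl⟩ := mem_Ds.1 hx
  exact mem_Ds.2 ⟨φ z, by simp⟩

theorem clear_poly {S S' : Type*} [CommRing S] [CommRing S'] (g : S →+* S') (b : S)
    (h : ∀ x : S', ∃ k : ℕ, g b ^ k * x ∈ g.range) (x : S'[X]) :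
    ∃ k : ℕ, mapRingHom g (C b) ^ k * x ∈ (mapRingHom g).range := by
  have hup : ∀ (x : S'[X]) (k l : ℕ), k ≤ l → mapRingHom g (C b) ^ k * x ∈ (mapRingHom g).range →
      mapRingHom g (C b) ^ l * x ∈ (mapRingHom g).range := by
    intro x k l hkl hx
    obtain ⟨m, rfl⟩ := Nat.exists_eq_add_of_le hkl
    rw [pow_add, mul_comm (_ ^ k), mul_assoc]
    exact mul_mem (pow_mem (RingHom.mem_range_self _ _) _) hx
  induction x using Polynomial.induction_on' with
  | add x y hx hy =>
    obtain ⟨k, hk⟩ := hx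
    obtain ⟨l, hl⟩ := hy
    refine ⟨k + l, ?_⟩
    rw [mul_add]
    exact add_mem (hup _ _ _ (by omega) hk) (hup _ _ _ (by omega) hl)
  | monomial n a =>
    obtain ⟨k, c, hk⟩ := h a
    refine ⟨k, monomial n c, ?_⟩
    rw [coe_mapRingHom, map_monomial, hk, map_C, ← C_pow, C_mul_monomial]

/-- translation -/
noncomputable def shiftHom {L : Type*} [CommRing L] (c : L) : L[X] →+* L[X][X] :=
  eval₂RingHom (C.comp C) (C X + C (C c) * X)

/-- scaling of the second variable -/
noncomputable def scaleHom {L : Type*} [CommRing L] (c : L) : L[X][X] →+* L[X][X] :=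
  eval₂RingHom C (C (C c) * X)

theorem scale_shift {L : Type*} [CommRing L] (c : L) (x : L[X]) :
    scaleHom c (shiftHom 1 x) = shiftHom c x := by
  have : (scaleHom c).comp (shiftHom 1) = shiftHom c := by
    refine Polynomial.ringHom_ext ?_ ?_
    · intro a; simp [scaleHom, shiftHom]
    · simp [scaleHom, shiftHom]
  exact congrArg (fun f => f x) this

theorem scale_C {L : Type*} [CommRing L] (c : L) (x : L[X]) : scaleHom c (C x) = C x := by
  simp [scaleHom]

theorem shift_diff {L : Type*} [CommRing L] (z : L[X]) :
    ∃ z' : L[X][X], C z - shiftHom 1 z = X * z' := by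
  have h := Polynomial.sub_dvd_eval_sub (C X) (C X + X : L[X][X]) (z.map (C.comp C))
  rw [eval_map, eval_map] at h
  have h1 : eval₂ (C.comp C : L →+* L[X][X]) (C X) z = C z := by
    have : eval₂RingHom (C.comp C : L →+* L[X][X]) (C X) = (C : L[X] →+* L[X][X]) := by
      refine Polynomial.ringHom_ext ?_ ?_ <;> simp
    exact congrArg (fun f => f z) this
  have h2 : eval₂ (C.comp C : L →+* L[X][X]) (C X + X) z = shiftHom 1 z := by
    simp [shiftHom]
  rw [h1, h2] at h
  obtain ⟨w, hw⟩ := h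
  exact ⟨-w, by rw [hw]; ring⟩

theorem elem_dilate {n : Type*} [Fintype n] [DecidableEq n] (hn : ∀ i j : n, ∃ k, k ≠ i ∧ k ≠ j)
    {R L : Type*} [CommRing R] [CommRing L] (α : R →+* L) (b s0 : R)
    (hb : ∀ x : L, ∃ k : ℕ, α b ^ k * x ∈ α.range)
    {M : Matrix n n L[X]} (hM : M ∈ Elem n (Ds (C (α (s0 ^ 2))))) :
    ∃ N0, ∀ N ≥ N0, ∃ T ∈ Elem n (Ds (C (C s0) : R[X][X])),
      M.map (shiftHom (α b ^ N)) * T.map (mapRingHom (mapRingHom α)) = M.map C := by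
  set Φ : R[X][X] →+* L[X][X] := mapRingHom (mapRingHom α) with hΦ
  induction hM using Submonoid.closure_induction_left with
  | one =>
    refine ⟨0, fun N _ => ⟨1, one_mem _, ?_⟩⟩
    rw [Matrix.map_one _ (map_zero _) (map_one _), Matrix.map_one _ (map_zero _) (map_one _),
      Matrix.map_one _ (map_zero _) (map_one _), one_mul]
  | mul_left e he M hM ih =>
    obtain ⟨i, j, x, hij, hx, rfl⟩ := he
    obtain ⟨z, rfl⟩ := mem_Ds.1 hx
    obtain ⟨N2, hN2⟩ := ih
    obtain ⟨M', -, hMM', hM'M⟩ := Elem.exists_inv hM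
    obtain ⟨z', hz'⟩ := shift_diff z
    let G := M.map (shiftHom (1 : L))
    let H := M'.map (shiftHom (1 : L))
    have hclear : ∀ x : L[X][X], ∃ k : ℕ, Φ (C (C b)) ^ k * x ∈ Φ.range :=
      clear_poly (mapRingHom α) (C b) (clear_poly α b hb)
    have hΦb : Φ (C (C b)) = C (C (α b)) := by simp [hΦ]
    have hΦs : Φ (C (C s0)) = C (C (α s0)) := by simp [hΦ]
    have hup : ∀ (x : L[X][X]) (k l : ℕ), k ≤ l → Φ (C (C b)) ^ k * x ∈ Φ.range →
      Φ (C (C b)) ^ l * x ∈ Φ.range := by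
      intro x k l hkl hx
      obtain ⟨m, rfl⟩ := Nat.exists_eq_add_of_le hkl
      rw [pow_add, mul_comm (_ ^ k), mul_assoc]
      exact mul_mem (pow_mem (RingHom.mem_range_self _ _) _) hx
    have hfam : ∀ (κ : Type _) [Fintype κ] (y : κ → L[X][X]), ∃ k, ∀ i, Φ (C (C b)) ^ k * y i ∈ Φ.range := by
      intro κ _ y
      choose k hk using fun i => hclear (y i)
      exact ⟨∑ i, k i, fun i => hup _ _ _ (Finset.single_le_sum (fun _ _ => Nat.zero_le _)
        (Finset.mem_univ i)) (hk i)⟩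
    obtain ⟨k1, hk1⟩ := hfam n (fun a => H a i)
    obtain ⟨k2, hk2⟩ := hfam (n × n × n) (fun a => z' * (G i a.1 * G j a.2.1 * H a.2.2 i))
    obtain ⟨k3, hk3⟩ := hfam (n × n × n × n)
      (fun a => z' * (G i a.1 * G j a.2.1 * H a.2.2.1 i * H a.2.2.2 i))
    refine ⟨N2 + k1 + k2 + k3, fun N hN => ?_⟩
    obtain ⟨T2, hT2, hT2e⟩ := hN2 N (by omega)
    let c : L := α b ^ N
    -- scaled version of clearing
    have hscale : ∀ x : L[X][X], x ∈ Φ.range → scaleHom c x ∈ Φ.range := by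
      rintro _ ⟨x, rfl⟩
      refine ⟨scaleHom (b ^ N) x, ?_⟩
      have : Φ.comp (scaleHom (b ^ N)) = (scaleHom c).comp Φ := by
        refine Polynomial.ringHom_ext ?_ ?_
        · intro a
          simp [scaleHom, hΦ]
        · simp [scaleHom, hΦ, c]
      exact congrArg (fun f => f x) this
    have hscale' : ∀ (k : ℕ) (x : L[X][X]), Φ (C (C b)) ^ k * x ∈ Φ.range →
        Φ (C (C b)) ^ k * scaleHom c x ∈ Φ.range := by
      intro k x hx
      have := hscale _ hx
      rw [map_mul, map_pow, hΦb, scale_C] at this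
      rw [hΦb]; exact this
    let D : AddSubgroup L[X][X] := (Ds (C (C s0) : R[X][X])).map Φ.toAddMonoidHom
    have hD : ∀ x ∈ Φ.range, C (C (α s0)) * x ∈ D := by
      rintro _ ⟨x, rfl⟩
      refine ⟨C (C s0) * x, mem_Ds.2 ⟨x, rfl⟩, ?_⟩
      show Φ (C (C s0) * x) = _
      rw [map_mul, hΦs]
    let Gc := G.map (scaleHom c)
    let Hc := H.map (scaleHom c)
    have hGH : G * H = 1 := by
      show M.map _ * M'.map _ = 1
      rw [← Matrix.map_mul, hMM', Matrix.map_one _ (map_zero _) (map_one _)]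
    have hHG : H * G = 1 := by
      show M'.map _ * M.map _ = 1
      rw [← Matrix.map_mul, hM'M, Matrix.map_one _ (map_zero _) (map_one _)]
    have hGHc : Gc * Hc = 1 := by
      show G.map _ * H.map _ = 1
      rw [← Matrix.map_mul, hGH, Matrix.map_one _ (map_zero _) (map_one _)]
    have hHGc : Hc * Gc = 1 := by
      show H.map _ * G.map _ = 1
      rw [← Matrix.map_mul, hHG, Matrix.map_one _ (map_zero _) (map_one _)]
    have hGc : Gc = M.map (shiftHom c) := by
      refine Matrix.ext fun a e => ?_
      show scaleHom c (shiftHom 1 _) = _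
      rw [scale_shift]; rfl
    let β : L[X][X] := Φ (C (C b))
    let σ : L[X][X] := C (C (α s0))
    let Z : L[X][X] := scaleHom c z'
    have hXr : (X : L[X][X]) ∈ Φ.range := ⟨X, by simp [hΦ]⟩
    have hsr : σ ∈ Φ.range := ⟨C (C s0), hΦs⟩
    have hscX : scaleHom c X = β ^ N * X := by
      simp only [scaleHom, c, β, hΦb]; simp
    have hup' : ∀ (k : ℕ) (x : L[X][X]), k ≤ N → β ^ k * x ∈ Φ.range → β ^ N * x ∈ Φ.range :=
      fun k x hk => hup x k N hk
    have hmem := Elem.suslin (D := D) (fun a => Hc a i) (Gc j) (Gc i)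
      (by have := congrFun (congrFun hGHc i) i; rw [Matrix.one_apply_eq] at this; exact this)
      (by have := congrFun (congrFun hGHc j) i; rw [Matrix.one_apply_ne (Ne.symm hij)] at this; exact this)
      (σ * β ^ k1) (σ * (β ^ (N - k1) * (X * Z))) hn
      (by
        intro a
        rw [mul_assoc]
        exact hD _ (hscale' _ _ (hk1 a)))
      (by
        intro a e l
        rw [mul_assoc]
        refine hD _ ?_
        have h1 := hscale' _ _ (hk2 (a, e, l))
        have h2 := hup _ k2 (N - k1) (by omega) h1
        have h3 := mul_mem hXr h2
        convert h3 using 1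
        simp only [map_mul]
        show _ = X * (β ^ (N - k1) * (Z * (Gc i a * Gc j e * Hc l i)))
        ring)
      (by
        intro a e l m
        have h1 := hscale' _ _ (hk3 (a, e, l, m))
        have h2 := hup _ k3 N (by omega) h1
        have h3 := hD _ (mul_mem hsr (mul_mem hXr h2))
        convert h3 using 1
        simp only [map_mul]
        show _ = σ * (σ * (X * (β ^ N * (Z * (Gc i a * Gc j e * Hc l i * Hc m i)))))
        have : β ^ N = β ^ k1 * β ^ (N - k1) := by rw [← pow_add]; congr 1; omega
        rw [this]
        ring)
    obtain ⟨T1, hT1, hT1e⟩ := Elem.lift_mem Φ hmem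
    have hθ : (σ * β ^ k1) * (σ * (β ^ (N - k1) * (X * Z))) = scaleHom c (C (C (α (s0 ^ 2))) * (X * z')) := by
      rw [map_mul, map_mul, hscX, scale_C]
      have : β ^ N = β ^ k1 * β ^ (N - k1) := by rw [← pow_add]; congr 1; omega
      rw [this, map_pow, C_pow, C_pow]
      show _ = σ ^ 2 * (β ^ k1 * β ^ (N - k1) * X * Z)
      ring
    rw [hθ] at hT1e
    refine ⟨T1 * T2, mul_mem hT1 hT2, ?_⟩
    have hconj : T1.map Φ = Hc * transvection i j (scaleHom c (C (C (α (s0 ^ 2))) * (X * z'))) * Gc := by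
      rw [hT1e, ← mul_one (scaleHom c (C (C (α (s0 ^ 2))) * (X * z'))), ← Elem.outer_single, mul_add, add_mul,
        mul_one, mul_one, hHGc, mul_vecMulVec, vecMulVec_mul]
      congr 2
      · ext a : 1
        simp [mul_comm]
      · ext a : 1
        simp
    have htr : ∀ (w : L[X]) (g : L[X] →+* L[X][X]), (transvection i j w).map g = transvection i j (g w) := by
      intro w g
      simp only [transvection]
      rw [Matrix.map_add g (by simp)]
      simp
    rw [Matrix.map_mul, Matrix.map_mul, Matrix.map_mul, hconj, ← hT2e, ← hGc, htr, htr]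
    calc _ = transvection i j (shiftHom (α b ^ N) (C (α (s0 ^ 2)) * z)) * (Gc * Hc) *
          transvection i j (scaleHom c (C (C (α (s0 ^ 2))) * (X * z'))) * (Gc * T2.map Φ) := by
          simp only [mul_assoc]
      _ = _ := by
        rw [hGHc, mul_one, transvection_mul_transvection_same _ _ hij]
        congr 2
        rw [← hz', ← scale_shift, ← map_add, ← scale_C (α b ^ N) (C (α (s0 ^ 2)) * z)]
        congr 1
        rw [map_mul (shiftHom 1), map_mul C]
        have : shiftHom (1 : L) (C (α (s0 ^ 2))) = C (C (α (s0 ^ 2))) := by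
          rw [shiftHom, coe_eval₂RingHom, eval₂_C]; rfl
        rw [this]; ring

/-- the ideal of good translations -/
def lgIdeal.{u} {n : Type*} [Fintype n] [DecidableEq n] {R : Type u} [CommRing R] (s0 : R)
    (v : n → R[X]) : Ideal R where
  carrier := {b | ∀ (T : Type u) [CommRing T] (ρ : R →+* T) (y w : T), ∃ M ∈ Elem n (Ds (ρ s0)),
    M *ᵥ (fun i => (v i).eval₂ ρ y) = fun i => (v i).eval₂ ρ (y + ρ b * w)}
  zero_mem' := by
    intro T _ ρ y w
    refine ⟨1, one_mem _, ?_⟩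
    simp
  add_mem' := by
    intro b b' h h' T _ ρ y w
    obtain ⟨M, hM, e⟩ := h T ρ y w
    obtain ⟨M', hM', e'⟩ := h' T ρ (y + ρ b * w) w
    refine ⟨M' * M, mul_mem hM' hM, ?_⟩
    rw [← Matrix.mulVec_mulVec, e, e']
    simp [add_mul, add_assoc]
  smul_mem' := by
    intro r b h T _ ρ y w
    obtain ⟨M, hM, e⟩ := h T ρ y (ρ r * w)
    refine ⟨M, hM, ?_⟩
    rw [e]
    simp only [smul_eq_mul, map_mul]
    ext i
    congr 1
    ring

theorem lg_local.{u} {n : Type*} [Fintype n] [DecidableEq n] (hn : ∀ i j : n, ∃ k, k ≠ i ∧ k ≠ j)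
    {R L : Type u} [CommRing R] [CommRing L] (α : R →+* L) (hα : Function.Injective α) (b s0 : R)
    (hb : ∀ x : L, ∃ k : ℕ, α b ^ k * x ∈ α.range) (v : n → R[X]) (w : n → L)
    {M : Matrix n n L[X]} (hM : M ∈ Elem n (Ds (C (α (s0 ^ 2)))))
    (hMv : M *ᵥ (fun i => (v i).map α) = fun i => C (w i)) :
    ∃ N, b ^ N ∈ lgIdeal s0 v := by
  obtain ⟨N, hN⟩ := elem_dilate hn α b s0 hb hM
  refine ⟨N, ?_⟩
  obtain ⟨T, hT, hTe⟩ := hN N le_rfl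
  set Φ : R[X][X] →+* L[X][X] := mapRingHom (mapRingHom α) with hΦ
  have hΦinj : Function.Injective Φ := by
    have : Function.Injective (mapRingHom α) := Polynomial.map_injective α hα
    exact Polynomial.map_injective _ this
  obtain ⟨M', -, hMM', hM'M⟩ := Elem.exists_inv hM
  have hC : M.map (C : L[X] →+* L[X][X]) *ᵥ (fun i => C ((v i).map α)) = fun i => C (C (w i)) := by
    have := congrArg (fun t : n → L[X] => fun i => (C (t i) : L[X][X])) hMv
    rw [← this]
    ext i : 1
    rw [RingHom.map_mulVec]
    rfl
  have hS : M.map (shiftHom (α b ^ N)) *ᵥ (fun i => shiftHom (α b ^ N) ((v i).map α)) = fun i => C (C (w i)) := by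
    have := congrArg (fun t : n → L[X] => fun i => (shiftHom (α b ^ N) (t i) : L[X][X])) hMv
    have h2 : (fun i => shiftHom (α b ^ N) (C (w i))) = fun i => (C (C (w i)) : L[X][X]) := by
      ext i : 1
      rw [shiftHom, coe_eval₂RingHom, eval₂_C]; rfl
    rw [← h2, ← this]
    ext i : 1
    rw [RingHom.map_mulVec]
    rfl
  have hcancel : M'.map (shiftHom (α b ^ N)) * M.map (shiftHom (α b ^ N)) = 1 := by
    rw [← Matrix.map_mul, hM'M, Matrix.map_one _ (map_zero _) (map_one _)]
  have hTv : T.map Φ *ᵥ (fun i => C ((v i).map α)) = fun i => shiftHom (α b ^ N) ((v i).map α) := by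
    have h1 : M.map (shiftHom (α b ^ N)) *ᵥ (T.map Φ *ᵥ (fun i => C ((v i).map α))) =
        M.map (shiftHom (α b ^ N)) *ᵥ (fun i => shiftHom (α b ^ N) ((v i).map α)) := by
      rw [Matrix.mulVec_mulVec, hTe, hC, hS]
    have h2 := congrArg (fun t => M'.map (shiftHom (α b ^ N)) *ᵥ t) h1
    simpa only [Matrix.mulVec_mulVec, hcancel, Matrix.one_mulVec, ← mul_assoc, one_mul] using h2
  have hTv' : T *ᵥ (fun i => C (v i)) = fun i => shiftHom (b ^ N) (v i) := by
    ext i : 1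
    apply hΦinj
    rw [RingHom.map_mulVec]
    have h1 : (Φ ∘ fun i => C (v i)) = fun i => C ((v i).map α) := by
      ext i : 1
      simp [hΦ]
    rw [h1, hTv]
    have h2 : (shiftHom (α b ^ N)).comp (mapRingHom α) = Φ.comp (shiftHom (b ^ N)) := by
      refine Polynomial.ringHom_ext ?_ ?_
      · intro a; simp [shiftHom, hΦ]
      · simp [shiftHom, hΦ]
    exact congrArg (fun f => f (v i)) h2
  intro S _ ρ y w
  let ev : R[X][X] →+* S := eval₂RingHom (eval₂RingHom ρ y) w
  refine ⟨T.map ev, Elem.map_mem ev ?_ hT, ?_⟩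
  · intro x hx
    have := map_Ds ev _ x hx
    simpa [ev] using this
  · have h1 : (fun i => (v i).eval₂ ρ y) = ev ∘ fun i => C (v i) := by
      ext i : 1
      simp [ev]
    ext i : 1
    rw [h1, ← RingHom.map_mulVec, hTv']
    have h2 : ev.comp (shiftHom (b ^ N)) = eval₂RingHom ρ (y + ρ (b ^ N) * w) := by
      refine Polynomial.ringHom_ext ?_ ?_
      · intro a; simp [shiftHom, ev]
      · generalize b ^ N = c
        simp [shiftHom, ev]
    exact congrArg (fun f => f (v i)) h2

theorem local_global.{u} {n : Type*} [Fintype n] [DecidableEq n] (hn : ∀ i j : n, ∃ k, k ≠ i ∧ k ≠ j)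
    {R : Type u} [CommRing R] [IsDomain R] (s0 : R) (v : n → R[X])
    (h : ∀ m : Ideal R, m.IsMaximal → ∃ b ∉ m, ∃ M ∈ Elem n (Ds (C (algebraMap R (Localization.Away b) (s0 ^ 2)))),
      ∃ w : n → Localization.Away b,
      M *ᵥ (fun i => (v i).map (algebraMap R (Localization.Away b))) = fun i => C (w i)) :
    ∃ M ∈ Elem n (Ds (C s0)), M *ᵥ v = fun i => C ((v i).eval 0) := by
  have htop : lgIdeal s0 v = ⊤ := by
    by_contra hne
    obtain ⟨m, hm, hle⟩ := Ideal.exists_le_maximal _ hne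
    obtain ⟨b, hb, M, hM, w, hMw⟩ := h m hm
    have hb0 : b ≠ 0 := fun h0 => hb (h0 ▸ m.zero_mem)
    obtain ⟨N, hN⟩ := lg_local hn (algebraMap R (Localization.Away b))
      (IsLocalization.injective _ (powers_le_nonZeroDivisors_of_noZeroDivisors hb0)) b s0 (by
        intro x
        obtain ⟨k, y, hy⟩ := IsLocalization.Away.surj b x
        refine ⟨k, y, ?_⟩
        rw [mul_comm]; exact hy.symm) v w hM hMw
    exact hb (hm.isPrime.mem_of_pow_mem _ (hle hN))
  have h1 : (1 : R) ∈ lgIdeal s0 v := htop ▸ Submodule.mem_top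
  obtain ⟨M, hM, e⟩ := h1 R[X] C X (-X)
  refine ⟨M, hM, ?_⟩
  have e1 : (fun i => (v i).eval₂ C X) = v := by ext i : 1; simp
  rw [e1] at e
  rw [e]
  ext i : 1
  simp [eval₂_at_zero, coeff_zero_eq_eval_zero]

end P3b

section P4
open Polynomial Matrix

/-- orbit relation -/
def ERel {n : Type*} [Fintype n] [DecidableEq n] {B : Type*} [CommRing B] (D : AddSubgroup B)
    (v w : n → B) : Prop := ∃ M ∈ Elem n D, M *ᵥ v = w

namespace ERel
variable {n : Type*} [Fintype n] [DecidableEq n] {B : Type*} [CommRing B] {D : AddSubgroup B}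

theorem refl (v : n → B) : ERel D v v := ⟨1, one_mem _, by simp⟩

theorem trans {u v w : n → B} (h : ERel D u v) (h' : ERel D v w) : ERel D u w := by
  obtain ⟨M, hM, rfl⟩ := h
  obtain ⟨M', hM', rfl⟩ := h'
  exact ⟨M' * M, mul_mem hM' hM, by rw [Matrix.mulVec_mulVec]⟩

theorem mono {D' : AddSubgroup B} (hD : D ≤ D') {v w : n → B} (h : ERel D v w) : ERel D' v w := by
  obtain ⟨M, hM, e⟩ := h
  exact ⟨M, Elem.mono hD hM, e⟩

theorem map {B' : Type*} [CommRing B'] (φ : B →+* B') {D' : AddSubgroup B'}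
    (hD : ∀ x ∈ D, φ x ∈ D') {v w : n → B} (h : ERel D v w) : ERel D' (φ ∘ v) (φ ∘ w) := by
  obtain ⟨M, hM, rfl⟩ := h
  refine ⟨M.map φ, Elem.map_mem φ hD hM, ?_⟩
  ext i
  rw [Function.comp_apply, RingHom.map_mulVec]

end ERel

theorem Ds_mono {B : Type*} [CommRing B] {s t : B} (h : t ∣ s) : Ds s ≤ Ds t := by
  intro x hx
  obtain ⟨z, rfl⟩ := mem_Ds.1 hx
  obtain ⟨w, rfl⟩ := h
  exact mem_Ds.2 ⟨w * z, by ring⟩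

def rowv {ι B : Type*} [CommRing B] (s a : B) (g : ι → B) : Option ι → B
  | none => a
  | some i => s * g i

theorem rowv_map {ι B B' : Type*} [CommRing B] [CommRing B'] (φ : B →+* B') (s a : B) (g : ι → B) :
    φ ∘ rowv s a g = rowv (φ s) (φ a) (φ ∘ g) := by
  ext o
  cases o <;> simp [rowv]

section moves
variable {ι : Type*} [Fintype ι] [DecidableEq ι] {B : Type*} [CommRing B]

theorem rowv_addg (s a : B) (g x : ι → B) :
    ERel (Ds s) (rowv s a g) (rowv s a (fun i => g i + x i * a)) := by
  let u : Option ι → B := fun o => o.elim 0 (fun i => s * x i)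
  refine ⟨1 + vecMulVec u (Pi.single none 1), Elem.col_mem u none rfl ?_, ?_⟩
  · intro o
    cases o with
    | none => exact (Ds s).zero_mem
    | some i => exact mem_Ds.2 ⟨x i, rfl⟩
  · rw [Matrix.add_mulVec, Matrix.one_mulVec, vecMulVec_mulVec]
    ext o
    cases o <;> simp [rowv, u]
    ring

theorem rowv_adda (s a : B) (g y : ι → B) :
    ERel (Ds s) (rowv s a g) (rowv s (a + s ^ 2 * ∑ i, y i * g i) g) := by
  let u : Option ι → B := fun o => o.elim 0 (fun i => s * y i)
  refine ⟨1 + vecMulVec (Pi.single none 1) u, Elem.row_mem u none rfl ?_, ?_⟩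
  · intro o
    cases o with
    | none => exact (Ds s).zero_mem
    | some i => exact mem_Ds.2 ⟨y i, rfl⟩
  · rw [Matrix.add_mulVec, Matrix.one_mulVec, vecMulVec_mulVec]
    ext o
    cases o
    · simp [rowv, u, dotProduct, Finset.mul_sum]
      refine Finset.sum_congr rfl fun i _ => by ring
    · simp [rowv]

theorem mem_span_range {g : ι → B} {x : B} (hx : x ∈ Ideal.span (Set.range g)) :
    ∃ y : ι → B, x = ∑ i, y i * g i := by
  obtain ⟨c, hc⟩ := (Submodule.mem_span_range_iff_exists_fun B).1 hx
  exact ⟨c, hc.symm⟩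

theorem rowv_finish (s a' : B) (g : ι → B) (h : a' ∈ Ideal.span (Set.range g)) :
    ERel (Ds s) (rowv s (1 + s ^ 2 * a') g) (Pi.single none 1) := by
  obtain ⟨y, rfl⟩ := mem_span_range h
  have h1 := rowv_adda s (1 + s ^ 2 * ∑ i, y i * g i) g (fun i => - y i)
  have e1 : 1 + s ^ 2 * ∑ i, y i * g i + s ^ 2 * ∑ i, - y i * g i = 1 := by
    simp
  rw [e1] at h1
  refine h1.trans ?_
  have h2 := rowv_addg s 1 g (fun i => - g i)
  convert h2 using 1
  ext o
  cases o <;> simp [rowv]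

end moves

/-- no prime contains `a` and all the `g i` -/
def Uni {ι B : Type*} [CommRing B] (a : B) (g : ι → B) : Prop :=
  ∀ p : Ideal B, p.IsPrime → a ∈ p → ¬ ∀ i, g i ∈ p

theorem ideal_eq_top_of_prime {B : Type*} [CommRing B] {I : Ideal B}
    (h : ∀ p : Ideal B, p.IsPrime → ¬ I ≤ p) : I = ⊤ := by
  by_contra hne
  obtain ⟨m, hm, hle⟩ := Ideal.exists_le_maximal _ hne
  exact h m hm.isPrime hle

theorem integral_of_X {R S : Type*} [CommRing R] [CommRing S] (π : R[X] →+* S)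
    (hπ : Function.Surjective π) (hX : (π.comp C).IsIntegralElem (π X)) :
    (π.comp C).IsIntegral := by
  intro x
  obtain ⟨x, rfl⟩ := hπ x
  induction x using Polynomial.induction_on' with
  | add a b ha hb => rw [map_add]; exact RingHom.IsIntegralElem.add _ ha hb
  | monomial n a =>
    rw [← C_mul_X_pow_eq_monomial, map_mul, map_pow]
    refine RingHom.IsIntegralElem.mul _ ((π.comp C).isIntegralElem_map (x := a)) ?_
    induction n with
    | zero => simpa using (π.comp C).isIntegralElem_one
    | succ n ih => rw [pow_succ]; exact RingHom.IsIntegralElem.mul _ ih hX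

/-- going up to a prime over `m` -/
theorem exists_const_mem {R : Type*} [CommRing R] (m : Ideal R) (hm : m.IsMaximal) (I : Ideal R[X])
    (h : R[X]) (hI : h ∈ I) (hlead : h.leadingCoeff ∉ m)
    (hno : ∀ p : Ideal R[X], p.IsPrime → I ≤ p → ¬ m ≤ p.comap C) : ∃ b ∉ m, C b ∈ I := by
  have hmp := hm.isPrime
  let _ : Algebra R[X] (Localization.AtPrime m)[X] := Polynomial.algebra R (Localization.AtPrime m)
  let Rm := Localization.AtPrime m
  let α := algebraMap R Rm
  let I' : Ideal Rm[X] := I.map (algebraMap R[X] Rm[X])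
  have hI' : I' = ⊤ := by
    by_contra hne
    obtain ⟨M, hM, hle⟩ := Ideal.exists_le_maximal _ hne
    have hMp := hM.isPrime
    have hu : IsUnit (α h.leadingCoeff) := IsLocalization.map_units Rm (⟨h.leadingCoeff, hlead⟩ : m.primeCompl)
    obtain ⟨u, hu⟩ := hu
    let k : Rm[X] := C (↑u⁻¹ : Rm) * h.map α
    have hk : k.Monic := by
      have h1 : (h.map α).leadingCoeff = u := by
        rw [leadingCoeff_map_of_leadingCoeff_ne_zero, hu]
        rw [← hu]; exact u.ne_zero
      have := monic_C_mul_of_mul_leadingCoeff_eq_one (p := h.map α) (b := (↑u⁻¹ : Rm)) (by rw [h1]; simp)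
      exact this
    have hkM : k ∈ M := by
      refine Ideal.mul_mem_left _ _ (hle ?_)
      exact Ideal.mem_map_of_mem (algebraMap R[X] Rm[X]) hI
    let φ : Rm →+* Rm[X] ⧸ M := (Ideal.Quotient.mk M).comp C
    have hφX : φ.IsIntegralElem (Ideal.Quotient.mk M X) := by
      refine ⟨k, hk, ?_⟩
      rw [← hom_eval₂]
      simpa [Ideal.Quotient.eq_zero_iff_mem] using hkM
    have hφ : φ.IsIntegral := integral_of_X _ Ideal.Quotient.mk_surjective hφX
    have hmax : (M.comap (C : Rm →+* Rm[X])).IsMaximal := by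
      let _ : Field (Rm[X] ⧸ M) := Ideal.Quotient.field M
      have h1 := Ideal.isMaximal_comap_of_isIntegral_of_isMaximal' φ hφ ⊥
      have h2 : (⊥ : Ideal (Rm[X] ⧸ M)).comap φ = M.comap C := by
        ext x
        simp [φ, Ideal.mem_comap, Ideal.Quotient.eq_zero_iff_mem]
      rwa [h2] at h1
    have hmx := IsLocalRing.eq_maximalIdeal hmax
    refine hno (M.comap (algebraMap R[X] Rm[X])) (hMp.comap _) (Ideal.map_le_iff_le_comap.1 hle) ?_
    intro x hx
    show algebraMap R[X] Rm[X] (C x) ∈ M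
    have h1 : α x ∈ M.comap (C : Rm →+* Rm[X]) := by
      rw [hmx]
      exact (IsLocalization.AtPrime.to_map_mem_maximal_iff Rm m x).2 hx
    have h2 : algebraMap R[X] Rm[X] (C x) = C (α x) := by
      rw [algebraMap_def]; simp [α]
    rw [h2]; exact h1
  have hloc : IsLocalization (Submonoid.map C m.primeCompl) Rm[X] :=
    Polynomial.isLocalization m.primeCompl (Localization.AtPrime m)
  have h1 : algebraMap R[X] Rm[X] 1 ∈ I' := by rw [hI']; trivial
  obtain ⟨y, hy, hyI⟩ := (IsLocalization.algebraMap_mem_map_algebraMap_iff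
    (Submonoid.map (C : R →+* R[X]) m.primeCompl) Rm[X] I 1).1 h1
  obtain ⟨b, hb, rfl⟩ := hy
  exact ⟨b, hb, by simpa using hyI⟩

end P4

section P5
open Polynomial Matrix

theorem mem_span_map {ι B B' : Type*} [CommRing B] [CommRing B'] (φ : B →+* B') (g : ι → B) {x : B}
    (hx : x ∈ Ideal.span (Set.range g)) : φ x ∈ Ideal.span (Set.range (φ ∘ g)) := by
  have := Ideal.mem_map_of_mem φ hx
  rwa [Ideal.map_span, ← Set.range_comp] at this

theorem local_step {ι : Type*} [Fintype ι] [DecidableEq ι] {R : Type*} [CommRing R]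
    (s b : R) (g x : ι → R[X]) (α' : R[X])
    (h : C b * α' ∈ Ideal.span (Set.range (fun i => g i + x i * (1 + C s ^ 2 * α')))) :
    ∃ M ∈ Elem (Option ι) (Ds (C (algebraMap R (Localization.Away b) s))),
      ∃ w : Option ι → Localization.Away b,
      M *ᵥ (fun i => (rowv (C s) (1 + C s ^ 2 * α') g i).map (algebraMap R (Localization.Away b))) =
        fun i => C (w i) := by
  let φ : R[X] →+* (Localization.Away b)[X] := mapRingHom (algebraMap R (Localization.Away b))
  have hu : IsUnit (φ (C b)) := by
    have : φ (C b) = C (algebraMap R (Localization.Away b) b) := by simp [φ]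
    rw [this]
    exact (IsLocalization.Away.algebraMap_isUnit b).map C
  have hs : φ (C s) = C (algebraMap R (Localization.Away b) s) := by simp [φ]
  have e1 : φ ∘ (fun i => g i + x i * (1 + C s ^ 2 * α')) =
      fun i => (φ ∘ g) i + (φ ∘ x) i * (1 + φ (C s) ^ 2 * φ α') := by
    ext1 i; simp only [Function.comp_apply, map_add, map_mul, map_one, map_pow]
  have h1 := mem_span_map φ _ h
  rw [map_mul, e1] at h1
  have h2 := (Ideal.unit_mul_mem_iff_mem _ hu).1 h1
  have h3 := (rowv_addg (φ (C s)) (1 + φ (C s) ^ 2 * φ α') (φ ∘ g) (φ ∘ x)).trans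
    (rowv_finish _ _ _ h2)
  obtain ⟨M, hM, hMe⟩ := h3
  refine ⟨M, hs ▸ hM, Pi.single none 1, ?_⟩
  have e2 : (fun i => (rowv (C s) (1 + C s ^ 2 * α') g i).map (algebraMap R (Localization.Away b)))
      = rowv (φ (C s)) (1 + φ (C s) ^ 2 * φ α') (φ ∘ g) := by
    have := rowv_map φ (C s) (1 + C s ^ 2 * α') g
    simp only [map_add, map_mul, map_one, map_pow] at this
    rw [← this]
    rfl
  rw [e2, hMe]
  ext1 i
  cases i <;> simp

theorem uni_top {ι B : Type*} [CommRing B] {a : B} {g g' : ι → B} (hU : Uni a g)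
    (hg : ∀ p : Ideal B, p.IsPrime → a ∈ p → (∀ i, g' i ∈ p) → ∀ i, g i ∈ p)
    (h : ∀ p : Ideal B, p.IsPrime → (∀ i, g' i ∈ p) → a ∈ p) :
    Ideal.span (Set.range g') = ⊤ := by
  apply ideal_eq_top_of_prime
  intro p hp hle
  have h1 : ∀ i, g' i ∈ p := fun i => hle (Ideal.subset_span ⟨i, rfl⟩)
  have h2 := h p hp h1
  exact hU p hp h2 (hg p hp h2 h1)

theorem mem_of_add_mul {B : Type*} [CommRing B] {p : Ideal B} {a g l : B} (ha : a ∈ p)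
    (h : g + l * a ∈ p) : g ∈ p := (Ideal.add_mem_iff_left p (p.mul_mem_left l ha)).1 h

theorem row_R {R : Type*} [CommRing R] (d : ℕ)
    (hdim : ringKrullDim R = d) {ι : Type*} [Fintype ι] [DecidableEq ι]
    (hcard : d + 1 ≤ Fintype.card ι) (s α' : R) (g : ι → R) (hU : Uni (1 + s ^ 2 * α') g) :
    ERel (Ds s) (rowv s (1 + s ^ 2 * α') g) (Pi.single none 1) := by
  obtain ⟨l, hl⟩ := kron_R d hdim (Finset.univ : Finset ι) hcard (1 + s ^ 2 * α') g
  refine (rowv_addg s _ g l).trans (rowv_finish _ _ _ ?_)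
  rw [uni_top hU (fun p hp ha h i => mem_of_add_mul ha (h i)) (fun p hp h => hl p hp fun i _ => h i)]
  trivial

theorem poly_row {R : Type*} [CommRing R] [IsDomain R] (d : ℕ)
    (hdim : ringKrullDim R = d) {ι : Type*} [Fintype ι] [DecidableEq ι]
    (hcard2 : 2 ≤ Fintype.card ι) (hcard : d + 1 ≤ Fintype.card ι) (s0 S x : R)
    (α' : R[X]) (g : ι → R[X]) (i0 : ι)
    (H1 : C (1 + S * x) * α' ∈ Ideal.span (Set.range g))
    (H2 : Uni (1 + C (s0 ^ 2) ^ 2 * α') g) (H3 : (g i0).leadingCoeff ∣ S) :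
    ERel (Ds (C s0)) (rowv (C (s0 ^ 2)) (1 + C (s0 ^ 2) ^ 2 * α') g) (Pi.single none 1) := by
  have hn : ∀ i j : Option ι, ∃ k, k ≠ i ∧ k ≠ j := by
    intro i j
    by_contra hcon
    push Not at hcon
    have h1 : (Finset.univ : Finset (Option ι)) ⊆ {i, j} := by
      intro k _
      by_cases hk : k = i
      · simp [hk]
      · simp [hcon k hk]
    have h2 := (Finset.card_le_card h1).trans Finset.card_le_two
    rw [Finset.card_univ, Fintype.card_option] at h2
    omega
  obtain ⟨M, hM, hMe⟩ := local_global hn s0 (rowv (C (s0 ^ 2)) (1 + C (s0 ^ 2) ^ 2 * α') g) (by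
    intro m hm
    by_cases hS : S ∈ m
    · refine ⟨1 + S * x, ?_, local_step (s0 ^ 2) (1 + S * x) g 0 α' (by simpa using H1)⟩
      intro h1
      refine hm.ne_top ((Ideal.eq_top_iff_one _).2 ?_)
      exact (Ideal.add_mem_iff_left m (m.mul_mem_right x hS)).1 h1
    · have hh : (g i0).leadingCoeff ∉ m := fun h => hS (by
        obtain ⟨c, hc⟩ := H3
        rw [hc]; exact m.mul_mem_right _ h)
      obtain ⟨l, hl⟩ := kron_m (Finset.univ.erase i0) (by
        rw [Finset.card_erase_of_mem (Finset.mem_univ _), Finset.card_univ]; omega) m hm (g i0) hh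
        (1 + C (s0 ^ 2) ^ 2 * α') g
      let l' : ι → R[X] := fun i => if i = i0 then 0 else l i
      obtain ⟨b, hb, hbI⟩ := exists_const_mem m hm
        (Ideal.span (Set.range (fun i => g i + l' i * (1 + C (s0 ^ 2) ^ 2 * α')))) (g i0)
        (Ideal.subset_span ⟨i0, by simp [l']⟩) hh (by
          intro p hp hle hmp
          have h1 : ∀ i, g i + l' i * (1 + C (s0 ^ 2) ^ 2 * α') ∈ p :=
            fun i => hle (Ideal.subset_span ⟨i, rfl⟩)
          have h2 : 1 + C (s0 ^ 2) ^ 2 * α' ∈ p := by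
            refine hl p hp (by simpa [l'] using h1 i0) hmp ?_
            intro i hi
            have := h1 i
            simpa [l', Finset.ne_of_mem_erase hi] using this
          exact H2 p hp h2 fun i => mem_of_add_mul h2 (h1 i))
      exact ⟨b, hb, local_step (s0 ^ 2) b g l' α' (Ideal.mul_mem_right _ _ hbI)⟩)
  refine ERel.trans ⟨M, hM, hMe⟩ ?_
  -- evaluate at zero
  let ev : R[X] →+* R := evalRingHom 0
  have e1 : (fun i => C ((rowv (C (s0 ^ 2)) (1 + C (s0 ^ 2) ^ 2 * α') g i).eval 0)) =
      (C : R →+* R[X]) ∘ rowv (s0 ^ 2) (1 + (s0 ^ 2) ^ 2 * ev α') (ev ∘ g) := by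
    have := rowv_map ev (C (s0 ^ 2)) (1 + C (s0 ^ 2) ^ 2 * α') g
    have e : ev (C s0) = s0 := eval_C
    simp only [map_add, map_mul, map_one, map_pow, e] at this
    rw [← this]
    ext1 i
    simp [ev]
  rw [e1]
  have h := (row_R d hdim hcard (s0 ^ 2) (ev α') (ev ∘ g) (by
    intro p hp ha hg
    refine H2 (p.comap ev) (hp.comap _) ?_ hg
    rw [Ideal.mem_comap]
    simpa [ev] using ha)).map (C : R →+* R[X]) (D' := Ds (C s0)) (by
      intro y hy
      obtain ⟨z, rfl⟩ := mem_Ds.1 hy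
      exact mem_Ds.2 ⟨C s0 * C z, by simp; ring⟩)
  convert h using 1
  ext1 i
  cases i <;> simp

end P5

section P6
open Polynomial Matrix

theorem exists_kappa {R A : Type*} [CommRing R] [IsDomain R] [CommRing A] [Algebra R[X] A]
    (f : R[X]) (hf : f ≠ 0) [IsLocalization.Away f A] (a : A) (ha : a ≠ 0) :
    ∃ (κ : R[X]) (c : A) (e : R), κ ≠ 0 ∧ e ≠ 0 ∧ algebraMap R[X] A κ = c * a ∧
      C e ∈ Ideal.span {κ, f} := by
  let K := FractionRing R
  let _ : Algebra R[X] K[X] := Polynomial.algebra R K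
  let M : Submonoid R[X] := Submonoid.map C (nonZeroDivisors R)
  have hloc : IsLocalization M K[X] := Polynomial.isLocalization (nonZeroDivisors R) K
  have hM : ∀ s ∈ M, s ≠ 0 := by
    rintro _ ⟨s, hs, rfl⟩
    simpa using nonZeroDivisors.ne_zero hs
  let θ : R[X] →+* K[X] := algebraMap R[X] K[X]
  have hθ : Function.Injective θ := IsLocalization.injective K[X] (M := M)
    (fun s hs => mem_nonZeroDivisors_of_ne_zero (hM s hs))
  let ψ := algebraMap R[X] A
  have hψ : Function.Injective ψ := IsLocalization.injective A (M := Submonoid.powers f)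
    (powers_le_nonZeroDivisors_of_noZeroDivisors hf)
  let I : Ideal R[X] := (Ideal.span {a}).comap ψ
  have hsat : ∀ q, f * q ∈ I → q ∈ I := by
    intro q hq
    have h1 : ψ f * ψ q ∈ Ideal.span {a} := by rw [← map_mul]; exact hq
    have h2 : ψ q ∈ Ideal.span {a} :=
      (Ideal.unit_mul_mem_iff_mem _ (IsLocalization.Away.algebraMap_isUnit f)).1 h1
    exact h2
  let J : Ideal K[X] := I.map θ
  have hJ : ∀ q, θ f * q ∈ J → q ∈ J := by
    intro q hq
    obtain ⟨⟨i, s⟩, h1⟩ := (IsLocalization.mem_map_algebraMap_iff M K[X]).1 hq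
    obtain ⟨⟨q0, c⟩, h2⟩ := IsLocalization.surj M q
    simp only at h1 h2
    have h3 : f * (s * q0) = c * i := by
      apply hθ
      simp only [map_mul]
      change θ f * q * θ s = θ i at h1
      change q * θ c = θ q0 at h2
      rw [← h1, ← h2]; ring
    have h4 := hsat _ (h3 ▸ I.mul_mem_left _ i.2)
    refine (IsLocalization.mem_map_algebraMap_iff M K[X]).2 ⟨⟨⟨_, h4⟩, s * c⟩, ?_⟩
    simp only [Submonoid.coe_mul, map_mul]
    rw [← h2]; ring
  obtain ⟨γ, hγ⟩ := IsPrincipalIdealRing.principal J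
  obtain ⟨δ, hδ⟩ := IsPrincipalIdealRing.principal (Ideal.span {γ, θ f})
  rw [← Ideal.span] at hγ hδ
  have hγJ : γ ∈ J := by rw [hγ]; exact Ideal.mem_span_singleton_self _
  have hγ0 : γ ≠ 0 := by
    rintro rfl
    obtain ⟨k, α, hα⟩ := IsLocalization.Away.surj f a
    have h1 : α ∈ I := by
      show ψ α ∈ Ideal.span {a}
      rw [← hα]
      exact Ideal.mul_mem_right _ _ (Ideal.mem_span_singleton_self _)
    have h2 : θ α ∈ J := Ideal.mem_map_of_mem _ h1
    rw [hγ] at h2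
    have h3 : α = 0 := hθ (by simpa using h2)
    apply ha
    rw [h3, map_zero] at hα
    exact (((IsLocalization.Away.algebraMap_isUnit f).pow k).mul_left_eq_zero).1 hα
  have h1 : γ ∈ Ideal.span {δ} := hδ ▸ Ideal.subset_span (by simp)
  have h2 : θ f ∈ Ideal.span {δ} := hδ ▸ Ideal.subset_span (by simp)
  obtain ⟨q, hq⟩ := Ideal.mem_span_singleton'.1 h1
  obtain ⟨f', hf'⟩ := Ideal.mem_span_singleton'.1 h2
  have h3 : q ∈ J := hJ q (by
    have : θ f * q = f' * γ := by rw [← hf', ← hq]; ring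
    rw [this]; exact J.mul_mem_left _ hγJ)
  rw [hγ] at h3
  obtain ⟨w, hw⟩ := Ideal.mem_span_singleton'.1 h3
  have h4 : w * δ = 1 := by
    apply mul_right_cancel₀ hγ0
    calc w * δ * γ = (w * γ) * δ := by ring
      _ = 1 * γ := by rw [hw, hq, one_mul]
  obtain ⟨⟨κ, s⟩, h5⟩ := (IsLocalization.mem_map_algebraMap_iff M K[X]).1 hγJ
  simp only at h5
  have h6 : (1 : K[X]) ∈ (Ideal.span {(κ : R[X]), f}).map θ := by
    have h7 : γ ∈ (Ideal.span {(κ : R[X]), f}).map θ := by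
      rw [← Ideal.mul_unit_mem_iff_mem _ (IsLocalization.map_units K[X] s), h5]
      exact Ideal.mem_map_of_mem θ (Ideal.subset_span (by simp))
    have h8 : θ f ∈ (Ideal.span {(κ : R[X]), f}).map θ :=
      Ideal.mem_map_of_mem _ (Ideal.subset_span (by simp))
    have h9 : Ideal.span {γ, θ f} ≤ (Ideal.span {(κ : R[X]), f}).map θ := by
      rw [Ideal.span_le]
      rintro x (rfl | rfl)
      · exact h7
      · exact h8
    apply h9
    rw [hδ]
    exact Ideal.mem_span_singleton'.2 ⟨w, h4⟩
  rw [← map_one θ] at h6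
  obtain ⟨y, hy, hyI⟩ := (IsLocalization.algebraMap_mem_map_algebraMap_iff M K[X] _ 1).1 h6
  obtain ⟨e, he, rfl⟩ := hy
  obtain ⟨c, hc⟩ := Ideal.mem_span_singleton'.1 (show ψ κ ∈ Ideal.span {a} from κ.2)
  refine ⟨κ, c, e, ?_, nonZeroDivisors.ne_zero he, hc.symm, by simpa using hyI⟩
  intro h0
  rw [h0, map_zero] at h5
  have := (IsLocalization.map_units K[X] s).mul_left_eq_zero.1 h5
  exact hγ0 this

theorem exists_lead {R : Type*} [CommRing R] [IsDomain R] (β κ f : R[X]) (hκ : κ ≠ 0) (hf : f ≠ 0)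
    (s : R) (hs : s ≠ 0) : ∃ M : ℕ, (β * f + C s * κ * (1 + f * X ^ M)).leadingCoeff =
      s * κ.leadingCoeff * f.leadingCoeff := by
  let M := (β * f + C s * κ).natDegree + 1
  refine ⟨M, ?_⟩
  have e : β * f + C s * κ * (1 + f * X ^ M) = (β * f + C s * κ) + C s * κ * f * X ^ M := by ring
  have h0 : C s * κ * f ≠ 0 := by
    simp [hs, hκ, hf]
  rw [e, leadingCoeff_add_of_degree_lt]
  · simp
  · rw [degree_mul, degree_X_pow]
    refine lt_of_le_of_lt degree_le_natDegree ?_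
    have h1 : (0 : WithBot ℕ) ≤ (C s * κ * f).degree := zero_le_degree_iff.2 h0
    calc ((β * f + C s * κ).natDegree : WithBot ℕ) < (M : WithBot ℕ) := by
          exact_mod_cast Nat.lt_succ_self _
      _ ≤ _ := le_add_of_nonneg_left h1

theorem Elem.conj {n : Type*} [Fintype n] [DecidableEq n] {B : Type*} [CommRing B] {s : B}
    (w : n → Bˣ) {M : Matrix n n B} (hM : M ∈ Elem n (Ds s)) :
    diagonal (fun i => (↑(w i)⁻¹ : B)) * M * diagonal (fun i => (w i : B)) ∈ Elem n (Ds s) := by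
  induction hM using Submonoid.closure_induction with
  | mem M h =>
    obtain ⟨i, j, x, hij, hx, rfl⟩ := h
    obtain ⟨z, rfl⟩ := mem_Ds.1 hx
    have : diagonal (fun i => (↑(w i)⁻¹ : B)) * transvection i j (s * z) * diagonal (fun i => (w i : B))
        = transvection i j (s * (↑(w i)⁻¹ * z * w j)) := by
      ext k l
      rw [Matrix.mul_diagonal, Matrix.diagonal_mul]
      simp only [transvection, Matrix.add_apply, Matrix.one_apply, Matrix.single_apply]
      by_cases hkl : k = l
      · subst hkl
        have : ¬ (i = k ∧ j = k) := fun h => hij (h.1.trans h.2.symm)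
        simp [this]
      · by_cases h : i = k ∧ j = l
        · obtain ⟨rfl, rfl⟩ := h
          simp [hkl]; ring
        · simp [hkl, h]
    rw [this]
    exact Elem.trans_mem hij (mem_Ds.2 ⟨_, rfl⟩)
  | one =>
    have : diagonal (fun i => (↑(w i)⁻¹ : B)) * 1 * diagonal (fun i => (w i : B)) = 1 := by
      rw [mul_one, Matrix.diagonal_mul_diagonal]; simp
    rw [this]; exact one_mem _
  | mul M N _ _ h1 h2 =>
    have : diagonal (fun i => (↑(w i)⁻¹ : B)) * (M * N) * diagonal (fun i => (w i : B)) =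
      (diagonal (fun i => (↑(w i)⁻¹ : B)) * M * diagonal (fun i => (w i : B))) *
      (diagonal (fun i => (↑(w i)⁻¹ : B)) * N * diagonal (fun i => (w i : B))) := by
      have h3 : diagonal (fun i => (w i : B)) * diagonal (fun i => (↑(w i)⁻¹ : B)) = 1 := by
        rw [Matrix.diagonal_mul_diagonal]; simp
      simp only [Matrix.mul_assoc]
      rw [← Matrix.mul_assoc (diagonal (fun i => (w i : B))) (diagonal (fun i => (↑(w i)⁻¹ : B))), h3,
        Matrix.one_mul]
    rw [this]; exact mul_mem h1 h2

theorem rowv_scale {ι : Type*} [Fintype ι] [DecidableEq ι] {B : Type*} [CommRing B] (s a : B)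
    (g : ι → B) (w : ι → Bˣ) (h : ERel (Ds s) (rowv (s ^ 2) a (fun i => g i * w i)) (Pi.single none 1)) :
    ERel (Ds s) (rowv (s ^ 2) a g) (Pi.single none 1) := by
  obtain ⟨M, hM, e⟩ := h
  let w' : Option ι → Bˣ := fun o => o.elim 1 w
  refine ⟨_, Elem.conj w' hM, ?_⟩
  rw [← Matrix.mulVec_mulVec, ← Matrix.mulVec_mulVec]
  have h1 : diagonal (fun i => (w' i : B)) *ᵥ rowv (s ^ 2) a g = rowv (s ^ 2) a (fun i => g i * w i) := by
    ext o
    rw [Matrix.mulVec_diagonal]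
    cases o <;> simp [rowv, w']
    ring
  rw [h1, e]
  ext o
  rw [Matrix.mulVec_diagonal]
  cases o <;> simp [w']

end P6

section P7
open Polynomial Matrix

theorem row_prep {R A : Type*} [CommRing R] [IsDomain R] (hP : IsPrufer R) (d : ℕ)
    (hdim : ringKrullDim R = d) [CommRing A] [Algebra R[X] A] (f : R[X]) (hf : f ≠ 0)
    [IsLocalization.Away f A] {ι : Type*} [Fintype ι] [DecidableEq ι]
    (hcard : d + 1 ≤ Fintype.card ι) (i0 : ι) (a : A) (ha : a ≠ 0) (g : ι → A) (hU : Uni a g) :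
    ∃ (S x' : R) (x : ι → A) (h : R[X]) (l : ℕ),
      (g i0 + x i0 * a) * algebraMap R[X] A f ^ l = algebraMap R[X] A h ∧
      h.leadingCoeff ∣ S ∧ C S ∈ Ideal.span {h, f} ∧
      algebraMap R[X] A (C (1 + S * x')) ∈ Ideal.span (Set.range (fun i => g i + x i * a)) := by
  obtain ⟨κ, c, e, hκ, he, hc, heI⟩ := exists_kappa f hf a ha
  set ψ := algebraMap R[X] A with hψ
  obtain ⟨s, hs⟩ : ∃ s, s = e * κ.leadingCoeff * f.leadingCoeff := ⟨_, rfl⟩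
  have hs0 : s ≠ 0 := by
    rw [hs]
    exact mul_ne_zero (mul_ne_zero he (leadingCoeff_ne_zero.2 hκ)) (leadingCoeff_ne_zero.2 hf)
  obtain ⟨l1, hl1⟩ := kron_s (A := A) hP d hdim f (Finset.univ : Finset ι) hcard (s ^ 2)
    (pow_ne_zero 2 hs0) a g
  obtain ⟨l, β, hβ⟩ := IsLocalization.Away.surj f (g i0 + l1 i0 * a)
  obtain ⟨M, hM⟩ := exists_lead β κ f hκ hf s hs0
  set h := β * f + C s * κ * (1 + f * X ^ M) with hh
  have hfu : IsUnit (ψ f) := IsLocalization.Away.algebraMap_isUnit f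
  obtain ⟨u, hu⟩ := hfu
  have huu : (↑u⁻¹ : A) * ψ f = 1 := by rw [← hu]; simp
  have huu' : ∀ n, (↑u⁻¹ : A) ^ n * ψ f ^ n = 1 := fun n => by rw [← mul_pow, huu, one_pow]
  -- second modification
  let l2 : ι → A := fun i => if i = i0 then
    (↑u⁻¹ : A) ^ (l + 1) * (ψ (C s) * (1 + ψ f * ψ X ^ M) * c) else 0
  let g2 : ι → A := fun i => g i + (l1 i + l2 i) * a
  have hg2 : g2 i0 * ψ f ^ (l + 1) = ψ h := by
    have e1 : ψ h = ψ β * ψ f + ψ (C s) * (c * a) * (1 + ψ f * ψ X ^ M) := by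
      rw [hh, ← hc]; simp only [map_add, map_mul, map_pow, map_one]
    rw [e1, ← hβ]
    simp only [g2, l2, if_true]
    linear_combination (ψ (C s) * (1 + ψ f * ψ X ^ M) * c * a) * huu' (l + 1)
  have hS2 : ∀ p : Ideal A, p.IsPrime → ψ (C (s ^ 2)) ∈ p → ¬ ∀ i, g2 i ∈ p := by
    intro p hp hS h2
    have hsp : ψ (C s) ∈ p := by
      rw [map_pow, map_pow] at hS
      exact hp.mem_of_pow_mem _ hS
    have h1 : ∀ i, g i + l1 i * a ∈ p := by
      intro i
      have h3 := h2 i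
      have h4 : l2 i ∈ p := by
        by_cases hi : i = i0
        · simp only [l2, hi, if_true]
          exact p.mul_mem_left _ (p.mul_mem_right _ (p.mul_mem_right _ hsp))
        · simp [l2, hi]
      have e1 : g2 i = g i + l1 i * a + l2 i * a := by simp only [g2]; ring
      rw [e1] at h3
      exact (Ideal.add_mem_iff_left p (p.mul_mem_right a h4)).1 h3
    have hap := hl1 p hp hS fun i _ => h1 i
    exact hU p hp hap fun i => mem_of_add_mul hap (h1 i)
  -- third modification
  obtain ⟨l3, hl3⟩ := kron_h (A := A) d hdim f (Finset.univ.erase i0) (by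
    rw [Finset.card_erase_of_mem (Finset.mem_univ _), Finset.card_univ]; omega) (s ^ 2) h
    (by rw [hM, hs]
        exact ⟨e, by ring_nf⟩) (ψ (C (s ^ 2)) * a) g2
  let l3' : ι → A := fun i => if i = i0 then 0 else l3 i * ψ (C (s ^ 2))
  let g3 : ι → A := fun i => g i + (l1 i + l2 i + l3' i) * a
  have hg3 : g3 i0 = g2 i0 := by simp [g3, g2, l3']
  have hg3' : ∀ i, i ≠ i0 → g3 i = g2 i + l3 i * (ψ (C (s ^ 2)) * a) := by
    intro i hi
    simp only [g3, g2, l3', if_neg hi]; ring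
  have hS3 : ∀ p : Ideal A, p.IsPrime → ψ (C (s ^ 2)) ∈ p → ¬ ∀ i, g3 i ∈ p := by
    intro p hp hS h3
    refine hS2 p hp hS fun i => ?_
    by_cases hi : i = i0
    · rw [hi, ← hg3]; exact h3 i0
    · have := h3 i
      rw [hg3' i hi] at this
      exact mem_of_add_mul (p.mul_mem_right a hS) this
  obtain ⟨z, hz1, hz2⟩ : ∃ z ∈ sigmaSet (s ^ 2), ψ (C z) ∈ Ideal.span (Set.range g3) := by
    by_contra hcon
    push Not at hcon
    obtain ⟨p, hp, hle, hdis⟩ := Ideal.exists_le_prime_disjoint (Ideal.span (Set.range g3))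
      ((sigmaSet (s ^ 2)).map (ψ.comp C)) (by
        rw [Set.disjoint_left]
        rintro _ hx ⟨z, hz, rfl⟩
        exact hcon z hz hx)
    have h3 : ∀ i, g3 i ∈ p := fun i => hle (Ideal.subset_span ⟨i, rfl⟩)
    have h4 : ψ (C (s ^ 2)) * a ∈ p := by
      refine hl3 p hp ?_ hdis ?_
      · rw [← hg2, ← hg3]; exact p.mul_mem_right _ (h3 i0)
      · intro i hi
        rw [← hg3' i (Finset.ne_of_mem_erase hi)]; exact h3 i
    have h5 : ψ (C (s ^ 2)) ∉ p := by
      intro h6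
      exact Set.disjoint_left.1 hdis h6 ⟨s ^ 2, ⟨1, 0, by simp⟩, rfl⟩
    have h6 : a ∈ p := (hp.mem_or_mem h4).resolve_left h5
    exact hU p hp h6 fun i => mem_of_add_mul h6 (h3 i)
  obtain ⟨N, x', rfl⟩ := hz1
  have htop : Ideal.span {ψ (C (s ^ 2))} ⊔ Ideal.span (Set.range g3) = ⊤ := by
    apply ideal_eq_top_of_prime
    intro p hp hle
    exact hS3 p hp (hle (Ideal.mem_sup_left (Ideal.mem_span_singleton_self _)))
      fun i => hle (Ideal.mem_sup_right (Ideal.subset_span ⟨i, rfl⟩))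
  refine ⟨s ^ 2, x', fun i => l1 i + l2 i + l3' i, h, l + 1, ?_, ?_, ?_, ?_⟩
  · show g3 i0 * _ = _
    rw [hg3, hg2]
  · rw [hM, hs]
    exact ⟨e, by ring_nf⟩
  · -- C (s^2)
    have h1 : C s * κ ∈ Ideal.span {h, f} := by
      have e1 : C s * κ = h - (β + C s * κ * X ^ M) * f := by rw [hh]; ring
      rw [e1]
      exact Ideal.sub_mem _ (Ideal.subset_span (by simp))
        (Ideal.mul_mem_left _ _ (Ideal.subset_span (by simp)))
    have h2 : C s * f ∈ Ideal.span {h, f} := Ideal.mul_mem_left _ _ (Ideal.subset_span (by simp))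
    obtain ⟨y, z, hyz⟩ := Ideal.mem_span_pair.1 heI
    have h3 : C (s ^ 2) = C (κ.leadingCoeff * f.leadingCoeff) * (y * (C s * κ) + z * (C s * f)) := by
      have e1 : C s = C (κ.leadingCoeff * f.leadingCoeff) * C e := by
        rw [← C_mul]; congr 1; rw [hs]; ring
      rw [map_pow, pow_two]
      nth_rewrite 1 [e1]
      rw [← hyz]; ring
    rw [h3]
    exact Ideal.mul_mem_left _ _ (Ideal.add_mem _ (Ideal.mul_mem_left _ _ h1) (Ideal.mul_mem_left _ _ h2))
  · show _ ∈ Ideal.span (Set.range g3)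
    have h1 : IsCoprime (Ideal.span {ψ (C (s ^ 2))}) (Ideal.span (Set.range g3)) :=
      Ideal.isCoprime_iff_sup_eq.2 htop
    obtain ⟨y, hy, w, hw, hyw⟩ := Ideal.isCoprime_iff_exists.1 (h1.pow_left (m := N))
    rw [Ideal.span_singleton_pow] at hy
    obtain ⟨y, rfl⟩ := Ideal.mem_span_singleton'.1 hy
    have e1 : ψ (C (1 + s ^ 2 * x')) = y * ψ (C ((s ^ 2) ^ N * (1 + s ^ 2 * x'))) +
        ψ (C (1 + s ^ 2 * x')) * w := by
      rw [C_mul, map_mul ψ, map_pow C (s ^ 2) N, map_pow ψ]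
      linear_combination (-ψ (C (1 + s ^ 2 * x'))) * hyw
    rw [e1]
    exact Ideal.add_mem _ (Ideal.mul_mem_left _ _ hz2) (Ideal.mul_mem_left _ _ hw)

theorem row_thm {R A : Type*} [CommRing R] [IsDomain R] (hP : IsPrufer R) (d : ℕ)
    (hdim : ringKrullDim R = d) [CommRing A] [Algebra R[X] A] (f : R[X]) (hf : f ≠ 0)
    [IsLocalization.Away f A] {ι : Type*} [Fintype ι] [DecidableEq ι]
    (hcard2 : 2 ≤ Fintype.card ι) (hcard : d + 1 ≤ Fintype.card ι) (s0 : R) (a' : A) (g : ι → A)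
    (hU : Uni (1 + algebraMap R[X] A (C s0) ^ 4 * a') g) :
    ERel (Ds (algebraMap R[X] A (C s0))) (rowv (algebraMap R[X] A (C s0) ^ 2)
      (1 + algebraMap R[X] A (C s0) ^ 4 * a') g) (Pi.single none 1) := by
  set ψ := algebraMap R[X] A with hψ
  set σ := ψ (C s0) with hσ
  set a := 1 + σ ^ 4 * a' with ha
  have hD : Ds (σ ^ 2) ≤ Ds σ := Ds_mono ⟨σ, by ring⟩
  by_cases ha0 : a = 0
  · have e1 : a = 1 + (σ ^ 2) ^ 2 * a' := by rw [ha]; ring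
    rw [e1]
    refine (rowv_finish (σ ^ 2) a' g ?_).mono hD
    rw [ideal_eq_top_of_prime (I := Ideal.span (Set.range g))]
    · trivial
    · intro p hp hle
      exact hU p hp (ha0 ▸ p.zero_mem) fun i => hle (Ideal.subset_span ⟨i, rfl⟩)
  have : Nonempty ι := Fintype.card_pos_iff.1 (by omega)
  obtain ⟨i0⟩ := this
  obtain ⟨S, x', x, h, l, hl, hlead, hSI, ht⟩ := row_prep hP d hdim f hf hcard i0 a ha0 g hU
  have hfu : IsUnit (ψ f) := IsLocalization.Away.algebraMap_isUnit f
  refine ((rowv_addg (σ ^ 2) a g x).mono hD).trans ?_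
  set g3 : ι → A := fun i => g i + x i * a with hg3
  have hU3 : Uni a g3 := fun p hp hap h => hU p hp hap fun i => mem_of_add_mul hap (h i)
  -- scaling
  obtain ⟨k, G, hG, hG0⟩ : ∃ (k : ι → ℕ) (G : ι → R[X]), (∀ i, g3 i * ψ f ^ k i = ψ (G i)) ∧ G i0 = h := by
    choose k G hG using fun i => IsLocalization.Away.surj f (g3 i)
    refine ⟨fun i => if i = i0 then l else k i, fun i => if i = i0 then h else G i, ?_, by simp⟩
    intro i
    by_cases hi : i = i0
    · simp only [hi, if_true]; exact hl
    · simp only [hi, if_false]; exact hG i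
  refine rowv_scale σ a g3 (fun i => (hfu.pow (k i)).unit) ?_
  have e1 : (fun i => g3 i * ((hfu.pow (k i)).unit : A)) = ψ ∘ G := by
    ext i; simp [hG i]
  rw [e1]
  have hGspan : Ideal.span (Set.range g3) ≤ Ideal.span (Set.range (ψ ∘ G)) := by
    rw [Ideal.span_le]
    rintro _ ⟨i, rfl⟩
    rw [SetLike.mem_coe, ← Ideal.mul_unit_mem_iff_mem _ (hfu.pow (k i)), hG]
    exact Ideal.subset_span ⟨i, rfl⟩
  have ht2 := hGspan ht
  have ht3 : ψ (C (1 + S * x')) ∈ (Ideal.span (Set.range G)).map ψ := by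
    rw [Ideal.map_span, ← Set.range_comp]; exact ht2
  obtain ⟨_, ⟨N, rfl⟩, hN⟩ := (IsLocalization.algebraMap_mem_map_algebraMap_iff
    (Submonoid.powers f) A _ _).1 ht3
  obtain ⟨m, α, hα⟩ := IsLocalization.Away.surj f a'
  -- comaximality
  obtain ⟨j, hj, z, hjz⟩ : ∃ j ∈ Ideal.span {h, C (1 + S * x')}, ∃ z, j + z * f ^ (N + 1 + m) = 1 := by
    obtain ⟨y1, y2, hy⟩ := Ideal.mem_span_pair.1 hSI
    have hc : IsCoprime (C (1 + S * x') - C x' * y1 * h) f := ⟨1, - C x' * y2, by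
      simp only [C_add, C_mul, C_1]
      linear_combination - C x' * hy⟩
    obtain ⟨b1, b2, hb⟩ := hc.pow_right (n := N + 1 + m)
    refine ⟨b1 * (C (1 + S * x') - C x' * y1 * h), ?_, b2, hb⟩
    refine Ideal.mul_mem_left _ _ (Ideal.sub_mem _ (Ideal.subset_span (by simp))
      (Ideal.mul_mem_left _ _ (Ideal.subset_span (by simp))))
  let α' : R[X] := z * f ^ (N + 1) * α
  have hjG : ψ j ∈ Ideal.span (Set.range (ψ ∘ G)) := by
    obtain ⟨y1, y2, rfl⟩ := Ideal.mem_span_pair.1 hj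
    rw [map_add, map_mul, map_mul]
    refine Ideal.add_mem _ (Ideal.mul_mem_left _ _ (Ideal.subset_span ⟨i0, ?_⟩)) (Ideal.mul_mem_left _ _ ht2)
    rw [Function.comp_apply, hG0]
  have hα' : ψ α' = a' - ψ j * a' := by
    have e2 : ψ j + ψ z * ψ f ^ (N + 1 + m) = 1 := by
      rw [← map_pow, ← map_mul, ← map_add, hjz, map_one]
    simp only [α', map_mul, map_pow]
    rw [← hα]
    linear_combination a' * e2
  obtain ⟨y, hy⟩ := mem_span_range (Ideal.mul_mem_right (-a') _ hjG)
  have e3 : a + (σ ^ 2) ^ 2 * ∑ i, y i * (ψ ∘ G) i = ψ (1 + C (s0 ^ 2) ^ 2 * α') := by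
    rw [← hy, map_add, map_mul, hα', ha, map_one, map_pow ψ, map_pow C, map_pow ψ, ← hσ]
    ring
  refine ((rowv_adda (σ ^ 2) a (ψ ∘ G) y).mono hD).trans ?_
  rw [e3]
  have hσ2 : σ ^ 2 = ψ (C (s0 ^ 2)) := by rw [map_pow, map_pow]
  have key := poly_row d hdim hcard2 hcard s0 S x' α' G i0 (by
    have e4 : C (1 + S * x') * α' = z * f * α * (f ^ N * C (1 + S * x')) := by
      simp only [α']; ring
    rw [e4]
    exact Ideal.mul_mem_left _ _ hN) (by
    intro p hp hap hGp
    have hfp : f ∉ p := by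
      intro hfp
      refine hp.ne_top ((Ideal.eq_top_iff_one _).2 ?_)
      have : C (s0 ^ 2) ^ 2 * α' ∈ p := by
        have e4 : C (s0 ^ 2) ^ 2 * α' = C (s0 ^ 2) ^ 2 * z * f ^ N * α * f := by simp only [α']; ring
        rw [e4]; exact p.mul_mem_left _ hfp
      exact (Ideal.add_mem_iff_left p this).1 hap
    have hdis : Disjoint (Submonoid.powers f : Set R[X]) p := by
      rw [Set.disjoint_left]
      rintro _ ⟨n, rfl⟩ hn
      exact hfp (hp.mem_of_pow_mem _ hn)
    have hpA := IsLocalization.isPrime_of_isPrime_disjoint (Submonoid.powers f) A p hp hdis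
    have h1 : ∀ i, g3 i ∈ p.map ψ := by
      intro i
      rw [← Ideal.mul_unit_mem_iff_mem _ (hfu.pow (k i)), hG]
      exact Ideal.mem_map_of_mem _ (hGp i)
    have h2 : Ideal.span (Set.range (ψ ∘ G)) ≤ p.map ψ := by
      rw [Ideal.span_le]
      rintro _ ⟨i, rfl⟩
      exact Ideal.mem_map_of_mem _ (hGp i)
    refine hU3 (p.map ψ) hpA ?_ h1
    have h3 := Ideal.mem_map_of_mem ψ hap
    rw [← e3, ← hy] at h3
    exact (Ideal.add_mem_iff_left _ (Ideal.mul_mem_left _ _ (Ideal.mul_mem_right _ _ (h2 hjG)))).1 h3)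
    (by rw [hG0]; exact hlead)
  have key2 := key.map ψ (D' := Ds σ) (by
    intro y hy
    obtain ⟨z, rfl⟩ := mem_Ds.1 hy
    exact mem_Ds.2 ⟨ψ z, by rw [map_mul]⟩)
  rw [rowv_map] at key2
  rw [hσ2]
  convert key2 using 1
  ext1 i
  cases i <;> simp

end P7

section P8
open Polynomial Matrix

/-- a basis of `P` up to inverting `δ` -/
def Chart {A : Type*} [CommRing A] (P : Type*) [AddCommGroup P] [Module A P] (ι : Type) [Fintype ι]
    [DecidableEq ι] (δ : A) : Prop :=
  ∃ (e : ι → P) (φ : ι → P →ₗ[A] A), (∀ i j, φ i (e j) = if i = j then δ else 0) ∧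
    ∀ p, δ • p = ∑ i, φ i p • e i

theorem lift_functional {A T P : Type*} [CommRing A] [CommRing T] [Algebra A T]
    (S : Submonoid A) [IsLocalization S T] (hinj : Function.Injective (algebraMap A T))
    [AddCommGroup P] [Module A P] [Module.Finite A P] (χ : P →ₗ[A] T) :
    ∃ t ∈ S, ∃ φ : P →ₗ[A] A, ∀ p, algebraMap A T (φ p) = algebraMap A T t * χ p := by
  obtain ⟨G, hG⟩ := Module.Finite.fg_top (R := A) (M := P)
  obtain ⟨t, ht⟩ := IsLocalization.exist_integer_multiples S G (fun p => χ p)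
  have h1 : ∀ p, (t : A) • χ p ∈ LinearMap.range (Algebra.linearMap A T) := by
    intro p
    have h2 : p ∈ Submodule.span A (G : Set P) := hG ▸ Submodule.mem_top
    induction h2 using Submodule.span_induction with
    | mem x hx =>
      obtain ⟨y, hy⟩ := ht x hx
      exact ⟨y, hy⟩
    | zero => simp
    | add x y _ _ hx hy => rw [map_add, smul_add]; exact Submodule.add_mem _ hx hy
    | smul c x _ hx => rw [map_smul, smul_comm]; exact Submodule.smul_mem _ _ hx
  let eqv := LinearEquiv.ofInjective (Algebra.linearMap A T) hinj
  let χ' : P →ₗ[A] LinearMap.range (Algebra.linearMap A T) := LinearMap.codRestrict _ ((t : A) • χ) h1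
  refine ⟨t, t.2, eqv.symm.toLinearMap ∘ₗ χ', ?_⟩
  intro p
  have h3 : eqv (eqv.symm (χ' p)) = χ' p := eqv.apply_symm_apply _
  have h4 := congrArg Subtype.val h3
  change algebraMap A T (eqv.symm (χ' p)) = _
  change algebraMap A T (eqv.symm (χ' p)) = _ at h4
  rw [h4, ← Algebra.smul_def]
  rfl

theorem exists_common_S {A : Type*} [CommRing A] (S : Submonoid A) {ι : Type*} [Fintype ι] (s : ι → A)
    (hs : ∀ i, s i ∈ S) : ∃ t ∈ S, ∀ i, s i ∣ t :=
  ⟨∏ i, s i, prod_mem fun i _ => hs i, fun i => Finset.dvd_prod_of_mem _ (Finset.mem_univ i)⟩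

theorem exists_chart {A T P M : Type*} [CommRing A] [IsDomain A] [CommRing T] [Algebra A T]
    (S : Submonoid A) (hS : S ≤ nonZeroDivisors A) [IsLocalization S T]
    [AddCommGroup P] [Module A P] [Module.Finite A P] [Module.Projective A P]
    [AddCommGroup M] [Module A M] [Module T M] [IsScalarTower A T M] (l : P →ₗ[A] M)
    [IsLocalizedModule S l] {ι : Type} [Fintype ι] [DecidableEq ι] (b : Module.Basis ι T M) :
    ∃ δ ∈ S, Chart P ι δ := by
  have hinj : Function.Injective (algebraMap A T) := IsLocalization.injective T hS
  have htf : Module.IsTorsionFree A P := inferInstance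
  have hl : ∀ x y : P, l x = l y → x = y := by
    intro x y hxy
    obtain ⟨c, hc⟩ := IsLocalizedModule.exists_of_eq (S := S) hxy
    have h0 : (c : A) ≠ 0 := nonZeroDivisors.ne_zero (hS c.2)
    exact smul_right_injective P h0 hc
  -- basis elements
  choose xs hxs using fun i => IsLocalizedModule.surj S l (b i)
  obtain ⟨s, hsS, hs⟩ := exists_common_S S (fun i => ((xs i).2 : A)) (fun i => (xs i).2.2)
  choose c hc using hs
  let e : ι → P := fun i => c i • (xs i).1
  have he : ∀ i, l (e i) = s • b i := by
    intro i
    rw [map_smul, ← hxs i, hc i, Submonoid.smul_def, smul_smul, mul_comm]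
  -- functionals
  choose t htS φ0 hφ0 using fun i : ι => lift_functional S (T := T) (P := P) hinj
    (((b.coord i).restrictScalars A) ∘ₗ l)
  obtain ⟨t', ht'S, ht'⟩ := exists_common_S S t htS
  choose c' hc' using ht'
  let φ : ι → P →ₗ[A] A := fun i => c' i • φ0 i
  have hφ : ∀ i p, algebraMap A T (φ i p) = algebraMap A T t' * b.repr (l p) i := by
    intro i p
    simp only [φ, LinearMap.smul_apply, smul_eq_mul, map_mul, hφ0, hc' i]
    simp only [LinearMap.comp_apply, LinearMap.restrictScalars_apply, Module.Basis.coord_apply]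
    ring
  refine ⟨t' * s, mul_mem ht'S hsS, e, φ, ?_, ?_⟩
  · intro i j
    apply hinj
    rw [hφ, he, ← algebraMap_smul T s (b j), map_smul, Finsupp.smul_apply, b.repr_self,
      Finsupp.single_apply]
    by_cases hij : i = j
    · simp [hij]
    · simp [hij, Ne.symm hij]
  · intro p
    apply hl
    rw [map_smul, map_sum]
    have h1 : ∀ i, l (φ i p • e i) = (t' * s) • ((b.repr (l p) i) • b i) := by
      intro i
      rw [map_smul, he, ← algebraMap_smul T (φ i p), hφ, ← algebraMap_smul T s (b i), smul_smul,
        ← algebraMap_smul T (t' * s), smul_smul, map_mul]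
      congr 1; ring
    simp only [h1]
    rw [← Finset.smul_sum, b.sum_repr]

theorem chart_le {A P : Type*} [CommRing A] [IsDomain A] [AddCommGroup P] [Module A P]
    {m n : ℕ} {δ σ : A} (hδ : δ ≠ 0) (hσ : σ ≠ 0) (h1 : Chart P (Fin m) δ) (h2 : Chart P (Fin n) σ) :
    m ≤ n := by
  obtain ⟨e, φ, he, hφ⟩ := h1
  obtain ⟨e', φ', he', hφ'⟩ := h2
  let F : (Fin m → A) →ₗ[A] (Fin n → A) := LinearMap.pi (fun j => φ' j) ∘ₗ
    Fintype.linearCombination A e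
  refine le_of_fin_injective A F ?_
  rw [← LinearMap.ker_eq_bot, LinearMap.ker_eq_bot']
  intro v hv
  have h3 : ∀ j, φ' j (∑ i, v i • e i) = 0 := by
    intro j
    have := congrFun hv j
    simpa [F, Fintype.linearCombination_apply] using this
  have h4 : σ • ∑ i, v i • e i = 0 := by
    rw [hφ']; simp only [h3]; simp
  ext k
  have h5 : φ k (σ • ∑ i, v i • e i) = 0 := by rw [h4, map_zero]
  rw [map_smul, map_sum] at h5
  simp only [map_smul, he, smul_eq_mul, mul_ite, mul_zero, Finset.sum_ite_eq, Finset.mem_univ,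
    if_true] at h5
  simpa [hσ, hδ] using h5

theorem pid_of_loc {B T : Type*} [CommRing B] [IsPrincipalIdealRing B] [CommRing T] [Algebra B T]
    (M : Submonoid B) [IsLocalization M T] : IsPrincipalIdealRing T := by
  constructor
  intro J
  obtain ⟨γ, hγ⟩ := IsPrincipalIdealRing.principal (J.under B)
  refine ⟨algebraMap B T γ, ?_⟩
  have h1 := IsLocalization.map_under M T J
  rw [← h1, hγ]
  change Ideal.map _ (Ideal.span {γ}) = Ideal.span _
  rw [Ideal.map_span, Set.image_singleton]

theorem generic_chart_aux {R A P B T : Type*} [CommRing R] [IsDomain R] [CommRing A] [IsDomain A]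
    [Algebra R[X] A] (f : R[X]) (hf : f ≠ 0) [IsLocalization.Away f A]
    [AddCommGroup P] [Module A P] [Module.Finite A P] [Module.Projective A P]
    [CommRing B] [IsDomain B] [IsPrincipalIdealRing B] [Algebra R[X] B]
    [IsLocalization (Submonoid.map (C : R →+* R[X]) (nonZeroDivisors R)) B]
    [CommRing T] [Algebra B T]
    [IsLocalization (Algebra.algebraMapSubmonoid B (Submonoid.powers f)) T] :
    ∃ (n : ℕ) (s : R), s ≠ 0 ∧ Chart P (Fin n) (algebraMap R[X] A (C s)) := by
  let M₁ : Submonoid R[X] := Submonoid.map C (nonZeroDivisors R)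
  have hM₁ : ∀ s ∈ M₁, s ≠ 0 := by
    rintro _ ⟨s, hs, rfl⟩
    simpa using nonZeroDivisors.ne_zero hs
  have hθ : Function.Injective (algebraMap R[X] B) := IsLocalization.injective B (M := M₁)
    (fun s hs => mem_nonZeroDivisors_of_ne_zero (hM₁ s hs))
  have hψ : Function.Injective (algebraMap R[X] A) := IsLocalization.injective A (M := Submonoid.powers f)
    (powers_le_nonZeroDivisors_of_noZeroDivisors hf)
  let N : Submonoid B := Algebra.algebraMapSubmonoid B (Submonoid.powers f)
  have hN : N ≤ nonZeroDivisors B := by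
    rintro _ ⟨_, ⟨n, rfl⟩, rfl⟩
    refine mem_nonZeroDivisors_of_ne_zero ?_
    simp only [map_pow]
    exact pow_ne_zero _ (by rwa [Ne, map_eq_zero_iff _ hθ])
  let _ : Algebra R[X] T := ((algebraMap B T).comp (algebraMap R[X] B)).toAlgebra
  have tow1 : IsScalarTower R[X] B T := IsScalarTower.of_algebraMap_eq fun _ => rfl
  have hunit : IsUnit (algebraMap R[X] T f) :=
    IsLocalization.map_units T (⟨algebraMap R[X] B f, f, Submonoid.mem_powers f, rfl⟩ : N)
  let _ : Algebra A T := (IsLocalization.Away.lift (S := A) f hunit).toAlgebra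
  have tow2 : IsScalarTower R[X] A T := IsScalarTower.of_algebraMap_eq fun x =>
    (IsLocalization.Away.lift_eq f hunit x).symm
  let S : Submonoid A := Algebra.algebraMapSubmonoid A M₁
  have hST : IsLocalization S T := IsLocalization.commutes A B T (Submonoid.powers f) M₁
  have hS : S ≤ nonZeroDivisors A := by
    rintro _ ⟨x, hx, rfl⟩
    refine mem_nonZeroDivisors_of_ne_zero ?_
    rw [Ne, map_eq_zero_iff _ hψ]; exact hM₁ x hx
  have : IsDomain T := IsLocalization.isDomain_of_le_nonZeroDivisors _ hN
  have : IsPrincipalIdealRing T := pid_of_loc N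
  have hfree : Module.Free T (TensorProduct A T P) := inferInstance
  have hlm : IsLocalizedModule S (TensorProduct.mk A T P 1) :=
    (isLocalizedModule_iff_isBaseChange S T _).2 (TensorProduct.isBaseChange A P T)
  let b := Module.finBasis T (TensorProduct A T P)
  obtain ⟨δ, ⟨_, ⟨s, hs, rfl⟩, rfl⟩, hδ⟩ := exists_chart S hS (TensorProduct.mk A T P 1) b
  exact ⟨_, s, nonZeroDivisors.ne_zero hs, hδ⟩

theorem generic_chart {R A P : Type*} [CommRing R] [IsDomain R] [CommRing A] [IsDomain A]
    [Algebra R[X] A] (f : R[X]) (hf : f ≠ 0) [IsLocalization.Away f A]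
    [AddCommGroup P] [Module A P] [Module.Finite A P] [Module.Projective A P] :
    ∃ (n : ℕ) (s : R), s ≠ 0 ∧ Chart P (Fin n) (algebraMap R[X] A (C s)) := by
  let K := FractionRing R
  let _ : Algebra R[X] K[X] := Polynomial.algebra R K
  have hloc : IsLocalization (Submonoid.map (C : R →+* R[X]) (nonZeroDivisors R)) K[X] :=
    Polynomial.isLocalization (nonZeroDivisors R) K
  exact generic_chart_aux (B := K[X])
    (T := Localization (Algebra.algebraMapSubmonoid K[X] (Submonoid.powers f))) f hf

theorem prime_chart {A P : Type*} [CommRing A] [IsDomain A]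
    [AddCommGroup P] [Module A P] [Module.Finite A P] [Module.Projective A P] (r : ℕ)
    (p : Ideal A) (hp : p.IsPrime)
    (hF : Module.Free (Localization.AtPrime p) (LocalizedModule p.primeCompl P))
    (hr : Module.finrank (Localization.AtPrime p) (LocalizedModule p.primeCompl P) = r) :
    ∃ δ ∉ p, Chart P (Fin r) δ := by
  have hfin : Module.Finite (Localization.AtPrime p) (LocalizedModule p.primeCompl P) :=
    Module.Finite.of_isLocalizedModule p.primeCompl (LocalizedModule.mkLinearMap p.primeCompl P)
  let b := Module.finBasisOfFinrankEq _ _ hr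
  obtain ⟨δ, hδ, h⟩ := exists_chart (T := Localization.AtPrime p) p.primeCompl
    (Ideal.primeCompl_le_nonZeroDivisors p) (LocalizedModule.mkLinearMap p.primeCompl P) b
  exact ⟨δ, hδ, h⟩

end P8

section P9
open Polynomial Matrix

theorem chart_sum {A : Type*} [CommRing A] {P : Type*} [AddCommGroup P] [Module A P] {ι : Type}
    [Fintype ι] [DecidableEq ι] {δ : A} (h : Chart P ι δ) (t : ℕ) :
    Chart (P × (Fin t → A)) (ι ⊕ Fin t) δ := by
  obtain ⟨e, φ, he, hφ⟩ := h
  refine ⟨Sum.elim (fun i => (e i, 0)) (fun k => (0, Pi.single k 1)),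
    Sum.elim (fun i => φ i ∘ₗ LinearMap.fst A P (Fin t → A))
      (fun k => δ • (LinearMap.proj k ∘ₗ LinearMap.snd A P (Fin t → A))), ?_, ?_⟩
  · rintro (i | i) (j | j)
    · simp [he]
    · simp
    · simp
    · simp [Pi.single_apply]
  · rintro ⟨p, x⟩
    rw [Fintype.sum_sum_type]
    simp only [Sum.elim_inl, Sum.elim_inr, LinearMap.comp_apply, LinearMap.fst_apply,
      LinearMap.smul_apply, LinearMap.snd_apply, LinearMap.proj_apply]
    ext k
    · simp [hφ, Prod.fst_sum]
    · simp [Prod.snd_sum, Pi.single_apply]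

/-- charts everywhere -/
def BigChart {A : Type*} [CommRing A] (P : Type*) [AddCommGroup P] [Module A P] (d : ℕ) (δ : A) : Prop :=
  ∃ (ι : Type) (_ : Fintype ι) (_ : DecidableEq ι), d + 1 ≤ Fintype.card ι ∧ 2 ≤ Fintype.card ι ∧ Chart P ι δ

def Good (R : Type*) {A : Type*} [CommRing R] [CommRing A] [Algebra R[X] A] (P : Type*) [AddCommGroup P]
    [Module A P] (d : ℕ) : Prop :=
  (∃ s : R, s ≠ 0 ∧ BigChart P d (algebraMap R[X] A (C s))) ∧
  ∀ p : Ideal A, p.IsPrime → ∃ δ ∉ p, BigChart P d δ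

theorem BigChart.sum {A : Type*} [CommRing A] {P : Type*} [AddCommGroup P] [Module A P] {d : ℕ} {δ : A}
    (h : BigChart P d δ) (t : ℕ) : BigChart (P × (Fin t → A)) d δ := by
  obtain ⟨ι, _, _, h1, h2, h3⟩ := h
  refine ⟨ι ⊕ Fin t, inferInstance, inferInstance, ?_, ?_, chart_sum h3 t⟩
  · rw [Fintype.card_sum]; omega
  · rw [Fintype.card_sum]; omega

theorem Good.sum {R A : Type*} [CommRing R] [CommRing A] [Algebra R[X] A] {P : Type*} [AddCommGroup P]
    [Module A P] {d : ℕ} (h : Good R (A := A) P d) (t : ℕ) : Good R (A := A) (P × (Fin t → A)) d := by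
  obtain ⟨⟨s, hs, h1⟩, h2⟩ := h
  refine ⟨⟨s, hs, h1.sum t⟩, fun p hp => ?_⟩
  obtain ⟨δ, hδ, h3⟩ := h2 p hp
  exact ⟨δ, hδ, h3.sum t⟩

/-- all functionals take `x` into `p` -/
def OIn {A P : Type*} [CommRing A] [AddCommGroup P] [Module A P] (p : Ideal A) (x : P) : Prop :=
  ∀ χ : P →ₗ[A] A, χ x ∈ p

theorem OIn.add_smul_iff {A P : Type*} [CommRing A] [AddCommGroup P] [Module A P] {p : Ideal A} {x q : P}
    {c : A} (hc : c ∈ p) : OIn p (x + c • q) ↔ OIn p x := by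
  refine forall_congr' fun χ => ?_
  rw [map_add, map_smul, smul_eq_mul]
  exact Ideal.add_mem_iff_left p (p.mul_mem_right _ hc)

theorem bass {R A : Type*} [CommRing R] [IsDomain R] (hP : IsPrufer R) (d : ℕ)
    (hdim : ringKrullDim R = d) [CommRing A] [Algebra R[X] A] (f : R[X])
    [IsLocalization.Away f A] {P : Type*} [AddCommGroup P] [Module A P]
    (hC : ∀ p : Ideal A, p.IsPrime → ∃ δ ∉ p, BigChart P d δ)
    (s : R) (hs : s ≠ 0) (a : A) (x : P) (hU : ∀ p : Ideal A, p.IsPrime → a ∈ p → ¬ OIn p x) :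
    ∃ q : P, ∀ p : Ideal A, p.IsPrime → algebraMap R[X] A (C s) ∈ p → ¬ OIn p (x + a • q) := by
  classical
  have hfin : ∀ L : Finset A, (∀ δ ∈ L, BigChart P d δ) → ∃ q : P, ∀ p : Ideal A, p.IsPrime →
      algebraMap R[X] A (C s) ∈ p → (∃ δ ∈ L, δ ∉ p) → ¬ OIn p (x + a • q) := by
    intro L
    induction L using Finset.induction_on with
    | empty => exact fun _ => ⟨0, fun p _ _ h => by simp at h⟩
    | insert δ L _ ih =>
      intro hL
      obtain ⟨q, hq⟩ := ih fun δ' h => hL δ' (Finset.mem_insert_of_mem h)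
      obtain ⟨ι, _, _, hcard, _, e, φ, he, hφ⟩ := hL δ (Finset.mem_insert_self _ _)
      obtain ⟨l, hl⟩ := kron_s (A := A) hP d hdim f (Finset.univ : Finset ι) hcard s hs (a * δ ^ 2)
        (fun i => φ i (x + a • q))
      refine ⟨q + δ • ∑ i, l i • e i, ?_⟩
      intro p hp hsp hex hO
      have e1 : x + a • (q + δ • ∑ i, l i • e i) = (x + a • q) + (a * δ) • ∑ i, l i • e i := by
        rw [smul_add, smul_smul, add_assoc]
      by_cases hδ : δ ∈ p
      · rw [e1, OIn.add_smul_iff (p.mul_mem_left _ hδ)] at hO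
        refine hq p hp hsp ?_ hO
        obtain ⟨δ', h1, h2⟩ := hex
        rcases Finset.mem_insert.1 h1 with rfl | h3
        · exact absurd hδ h2
        · exact ⟨δ', h3, h2⟩
      · have h1 : a * δ ^ 2 ∈ p := by
          refine hl p hp hsp fun i _ => ?_
          have h2 := hO (φ i)
          rw [e1, map_add, map_smul, map_sum] at h2
          simp only [map_smul, he, smul_eq_mul, mul_ite, mul_zero, Finset.sum_ite_eq, Finset.mem_univ,
            if_true] at h2
          convert h2 using 2
          ring
        have h2 : a ∈ p := (hp.mem_or_mem h1).resolve_right fun h => hδ (hp.mem_of_pow_mem _ h)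
        rw [OIn.add_smul_iff h2] at hO
        exact hU p hp h2 hO
  have htop : Ideal.span {δ : A | BigChart P d δ} = ⊤ := by
    apply ideal_eq_top_of_prime
    intro p hp hle
    obtain ⟨δ, hδ, h⟩ := hC p hp
    exact hδ (hle (Ideal.subset_span h))
  obtain ⟨L, hL, h1⟩ := Submodule.mem_span_finite_of_mem_span ((Ideal.eq_top_iff_one _).1 htop)
  obtain ⟨q, hq⟩ := hfin L fun δ h => hL h
  refine ⟨q, fun p hp hsp => hq p hp hsp ?_⟩
  by_contra hcon
  push Not at hcon
  refine hp.ne_top ((Ideal.eq_top_iff_one _).2 ?_)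
  have h2 : Submodule.span A (L : Set A) ≤ p := Submodule.span_le.2 hcon
  exact h2 h1

section tg
variable {A P : Type*} [CommRing A] [AddCommGroup P] [Module A P]

theorem tg_mk {M : Type*} [AddCommGroup M] [Module A M] (u : M) (φ : M →ₗ[A] A) (h0 : φ u = 0)
    (h : IsUnimodular A M u ∨ IsUnimodular A (M →ₗ[A] A) φ) :
    ∃ σ ∈ TransvectionGroup A M, ∀ q, σ q = q + φ q • u := by
  refine ⟨LinearEquiv.transvection h0, Subgroup.subset_closure ⟨u, φ, h0, h, ?_⟩, ?_⟩
  · intro q; rfl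
  · intro q; rfl

theorem tg_one (χ : P →ₗ[A] A) : ∃ σ ∈ TransvectionGroup A (A × P), ∀ a p, σ (a, p) = (a + χ p, p) := by
  obtain ⟨σ, h1, h2⟩ := tg_mk ((1, 0) : A × P) (χ ∘ₗ LinearMap.snd A A P) (by simp)
    (Or.inl ⟨LinearMap.fst A A P, by simp⟩)
  exact ⟨σ, h1, fun a p => by rw [h2]; simp⟩

theorem tg_two (q : P) : ∃ σ ∈ TransvectionGroup A (A × P), ∀ a p, σ (a, p) = (a, p + a • q) := by
  obtain ⟨σ, h1, h2⟩ := tg_mk ((0, q) : A × P) (LinearMap.fst A A P) (by simp)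
    (Or.inr ⟨LinearMap.applyₗ ((1, 0) : A × P), by simp⟩)
  exact ⟨σ, h1, fun a p => by rw [h2]; simp⟩

theorem tg_three (χ : P →ₗ[A] A) (q : P) (h : χ q = 0) :
    ∃ σ ∈ TransvectionGroup A (A × P), ∀ a p, σ (a, p) = (a, p + χ p • q) := by
  obtain ⟨σ1, h1, e1⟩ := tg_one χ
  obtain ⟨σ2, h2, e2⟩ := tg_one (-χ)
  obtain ⟨σ3, h3, e3⟩ := tg_two (A := A) q
  obtain ⟨σ4, h4, e4⟩ := tg_two (A := A) (-q)
  refine ⟨σ1 * σ4 * σ2 * σ3, mul_mem (mul_mem (mul_mem h1 h4) h2) h3, fun a p => ?_⟩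
  simp only [LinearEquiv.mul_apply, e1, e2, e3, e4]
  ext1
  · simp [h]
  · simp [h, sub_smul]; module

def phiMap {ι : Type} [Fintype ι] (e : ι → P) : (Option ι → A) →ₗ[A] A × P :=
  (LinearMap.proj none).prod (Fintype.linearCombination A e ∘ₗ LinearMap.funLeft A A some)

theorem phiMap_apply {ι : Type} [Fintype ι] (e : ι → P) (v : Option ι → A) :
    phiMap e v = (v none, ∑ i, v (some i) • e i) := by
  simp [phiMap, Fintype.linearCombination_apply, LinearMap.funLeft_apply]

theorem elem_act {ι : Type} [Fintype ι] [DecidableEq ι] (s : A) (e : ι → P) (φ : ι → P →ₗ[A] A)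
    (he : ∀ i j, φ i (e j) = if i = j then s else 0) {M : Matrix (Option ι) (Option ι) A}
    (hM : M ∈ Elem (Option ι) (Ds s)) :
    ∃ τ ∈ TransvectionGroup A (A × P), ∀ v, τ (phiMap e v) = phiMap e (M *ᵥ v) := by
  induction hM using Submonoid.closure_induction with
  | mem M h =>
    obtain ⟨i, j, x, hij, hx, rfl⟩ := h
    obtain ⟨z, rfl⟩ := mem_Ds.1 hx
    have hmv : ∀ v : Option ι → A, transvection i j (s * z) *ᵥ v = v + Pi.single i (s * z * v j) := by
      intro v
      rw [transvection, Matrix.add_mulVec, Matrix.one_mulVec, Matrix.single_mulVec]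
      rfl
    have hφ : ∀ k (v : Option ι → A), φ k (∑ i, v (some i) • e i) = s * v (some k) := by
      intro k v
      rw [map_sum]
      simp [he, mul_comm]
    cases i with
    | none =>
      cases j with
      | none => exact absurd rfl hij
      | some k =>
        obtain ⟨τ, h1, h2⟩ := tg_one (z • φ k)
        refine ⟨τ, h1, fun v => ?_⟩
        rw [hmv, phiMap_apply, phiMap_apply, h2]
        simp only [LinearMap.smul_apply, hφ]
        ext1
        · simp; ring
        · simp
    | some i =>
      cases j with
      | none =>
        obtain ⟨τ, h1, h2⟩ := tg_two (A := A) ((s * z) • e i)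
        refine ⟨τ, h1, fun v => ?_⟩
        rw [hmv, phiMap_apply, phiMap_apply, h2]
        ext1
        · simp
        · simp [Pi.single_apply, add_smul, Finset.sum_add_distrib, smul_smul, mul_comm, mul_left_comm]
      | some k =>
        have hik : k ≠ i := fun h => hij (by rw [h])
        obtain ⟨τ, h1, h2⟩ := tg_three (z • φ k) (e i) (by simp [he, hik])
        refine ⟨τ, h1, fun v => ?_⟩
        rw [hmv, phiMap_apply, phiMap_apply, h2]
        simp only [LinearMap.smul_apply, hφ]
        ext1
        · simp
        · simp [Pi.single_apply, add_smul, Finset.sum_add_distrib, mul_left_comm, mul_assoc]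
  | one => exact ⟨1, one_mem _, fun v => by simp⟩
  | mul M N _ _ h1 h2 =>
    obtain ⟨τ, hτ, e1⟩ := h1
    obtain ⟨τ', hτ', e2⟩ := h2
    exact ⟨τ * τ', mul_mem hτ hτ', fun v => by
      rw [LinearEquiv.mul_apply, e2, e1, Matrix.mulVec_mulVec]⟩

end tg

end P9

section P10
open Polynomial Matrix

theorem uni_prime {A P : Type*} [CommRing A] [AddCommGroup P] [Module A P] {a : A} {x : P}
    (h : IsUnimodular A (A × P) (a, x)) (p : Ideal A) (hp : p.IsPrime) (ha : a ∈ p) : ¬ OIn p x := by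
  intro hO
  obtain ⟨φ, hφ⟩ := h
  refine hp.ne_top ((Ideal.eq_top_iff_one _).2 ?_)
  have e1 : ((a, x) : A × P) = a • (1, 0) + (0, x) := by simp
  rw [← hφ, e1, map_add, map_smul, smul_eq_mul]
  exact p.add_mem (p.mul_mem_right _ ha) (hO (φ ∘ₗ LinearMap.inr A A P))

theorem uni_equiv {A M N : Type*} [CommRing A] [AddCommGroup M] [Module A M] [AddCommGroup N] [Module A N]
    (σ : M ≃ₗ[A] N) {m : M} (h : IsUnimodular A M m) : IsUnimodular A N (σ m) := by
  obtain ⟨φ, hφ⟩ := h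
  exact ⟨φ ∘ₗ σ.symm.toLinearMap, by simp [hφ]⟩

theorem core {R A : Type*} [CommRing R] [IsDomain R] (hP : IsPrufer R) (d : ℕ)
    (hdim : ringKrullDim R = d) [CommRing A] [Algebra R[X] A] (f : R[X]) (hf : f ≠ 0)
    [IsLocalization.Away f A] {P : Type*} [AddCommGroup P] [Module A P] (hG : Good R (A := A) P d)
    (v : A × P) (hv : IsUnimodular A (A × P) v) :
    ∃ τ ∈ TransvectionGroup A (A × P), τ v = (1, 0) := by
  obtain ⟨⟨s, hs, ι, _, _, hcard, hcard2, e, φ, he, hφ⟩, hC⟩ := hG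
  set σ := algebraMap R[X] A (C s) with hσ
  obtain ⟨a, x⟩ := v
  obtain ⟨q, hq⟩ := bass hP d hdim f hC s hs a x (fun p hp ha => uni_prime hv p hp ha)
  obtain ⟨τ1, hτ1, e1⟩ := tg_two (A := A) q
  set x1 := x + a • q with hx1
  -- make a congruent to one
  let O : Ideal A := LinearMap.range (LinearMap.applyₗ x1 : (P →ₗ[A] A) →ₗ[A] A)
  have htop : O ⊔ Ideal.span {σ ^ 4} = ⊤ := by
    apply ideal_eq_top_of_prime
    intro p hp hle
    refine hq p hp (hp.mem_of_pow_mem 4 (hle (Ideal.mem_sup_right (Ideal.mem_span_singleton_self _)))) ?_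
    intro χ
    exact hle (Ideal.mem_sup_left ⟨χ, rfl⟩)
  obtain ⟨o, ⟨φ0, ho⟩, w, hw, how⟩ := Submodule.mem_sup.1 ((Ideal.eq_top_iff_one _).1 htop)
  obtain ⟨y, rfl⟩ := Ideal.mem_span_singleton'.1 hw
  replace ho : φ0 x1 = o := ho
  obtain ⟨τ2, hτ2, e2⟩ := tg_one ((1 - a) • φ0)
  let a' : A := - ((1 - a) * y)
  have ha1 : a + ((1 - a) • φ0) x1 = 1 + σ ^ 4 * a' := by
    rw [LinearMap.smul_apply, smul_eq_mul, ho]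
    simp only [a']
    linear_combination (1 - a) * how
  set a1 := 1 + σ ^ 4 * a' with ha1'
  obtain ⟨τ3, hτ3, e3⟩ := tg_two (A := A) (-x1)
  let P0 : P := -(a' • x1)
  have hx2 : x1 + a1 • (-x1) = σ ^ 4 • P0 := by
    simp only [ha1', P0]
    module
  have hτ : (τ3 * τ2 * τ1) (a, x) = (a1, σ ^ 4 • P0) := by
    simp only [LinearEquiv.mul_apply, e1, e2, e3]
    rw [← hx1, ha1, hx2]
  have hU1 : IsUnimodular A (A × P) (a1, σ ^ 4 • P0) := hτ ▸ uni_equiv (τ3 * τ2 * τ1) hv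
  let g : ι → A := fun i => σ * φ i P0
  have hU : Uni a1 g := by
    intro p hp hap hgp
    have hσp : σ ∉ p := by
      intro h
      refine hp.ne_top ((Ideal.eq_top_iff_one _).2 ?_)
      refine (Ideal.add_mem_iff_left p (p.mul_mem_right a' (Ideal.pow_mem_of_mem p h 4 (by norm_num)))).1 hap
    refine uni_prime hU1 p hp hap ?_
    intro χ
    rw [map_smul, smul_eq_mul]
    have h1 : σ * χ P0 ∈ p := by
      rw [← smul_eq_mul, ← map_smul, hφ, map_sum]
      refine p.sum_mem fun i _ => ?_
      rw [map_smul, smul_eq_mul]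
      exact p.mul_mem_right _ ((hp.mem_or_mem (hgp i)).resolve_left hσp)
    have e4 : σ ^ 4 * χ P0 = σ ^ 3 * (σ * χ P0) := by ring
    rw [e4]; exact p.mul_mem_left _ h1
  obtain ⟨M, hM, hMe⟩ := row_thm hP d hdim f hf hcard2 hcard s a' g hU
  obtain ⟨τ4, hτ4, e4⟩ := elem_act σ e φ he hM
  refine ⟨τ4 * (τ3 * τ2 * τ1), mul_mem hτ4 (mul_mem (mul_mem hτ3 hτ2) hτ1), ?_⟩
  rw [LinearEquiv.mul_apply, hτ]
  have e5 : ((a1, σ ^ 4 • P0) : A × P) = phiMap e (rowv (σ ^ 2) a1 g) := by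
    rw [phiMap_apply]
    ext1
    · rfl
    · have : ∀ i, rowv (σ ^ 2) a1 g (some i) • e i = σ ^ 3 • (φ i P0 • e i) := by
        intro i
        simp only [rowv, g, smul_smul]
        congr 1; ring
      simp only [this]
      rw [← Finset.smul_sum, ← hφ, smul_smul]
      congr 1; ring
  rw [e5, e4, hMe, phiMap_apply]
  ext1 <;> simp

theorem cancel_one {R A : Type*} [CommRing R] [IsDomain R] (hP : IsPrufer R) (d : ℕ)
    (hdim : ringKrullDim R = d) [CommRing A] [Algebra R[X] A] (f : R[X]) (hf : f ≠ 0)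
    [IsLocalization.Away f A] {P Q : Type*} [AddCommGroup P] [Module A P] [AddCommGroup Q] [Module A Q]
    (hG : Good R (A := A) P d) (Θ : (A × P) ≃ₗ[A] (A × Q)) : Nonempty (P ≃ₗ[A] Q) := by
  obtain ⟨τ, -, hτ⟩ := core hP d hdim f hf hG (Θ.symm (1, 0))
    (uni_equiv Θ.symm ⟨LinearMap.fst A A Q, by simp⟩)
  let Ψ : (A × P) ≃ₗ[A] (A × Q) := τ.symm.trans Θ
  have h1 : Ψ (1, 0) = (1, 0) := by
    simp only [Ψ, LinearEquiv.trans_apply]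
    rw [← hτ]; simp
  have h2 : Ψ.symm (1, 0) = (1, 0) := by rw [LinearEquiv.symm_apply_eq, h1]
  have key : ∀ {M N : Type _} [AddCommGroup M] [Module A M] [AddCommGroup N] [Module A N]
      (F : (A × M) ≃ₗ[A] (A × N)), F.symm (1, 0) = (1, 0) →
      ∀ p : M, (F.symm (0, (F (0, p)).2)).2 = p := by
    intro M N _ _ _ _ F hF p
    have e1 : ((0, (F (0, p)).2) : A × N) = F (0, p) - (F (0, p)).1 • (1, 0) := by
      ext1 <;> simp
    rw [e1, map_sub, map_smul, hF]
    simp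
  have key2 : ∀ {M N : Type _} [AddCommGroup M] [Module A M] [AddCommGroup N] [Module A N]
      (F : (A × M) ≃ₗ[A] (A × N)), F (1, 0) = (1, 0) →
      ∀ p : N, (F (0, (F.symm (0, p)).2)).2 = p := by
    intro M N _ _ _ _ F hF p
    have e1 : ((0, (F.symm (0, p)).2) : A × M) = F.symm (0, p) - (F.symm (0, p)).1 • (1, 0) := by
      ext1 <;> simp
    rw [e1, map_sub, map_smul, hF]
    simp
  exact ⟨LinearEquiv.ofLinear
    (LinearMap.snd A A Q ∘ₗ Ψ.toLinearMap ∘ₗ LinearMap.inr A A P)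
    (LinearMap.snd A A P ∘ₗ Ψ.symm.toLinearMap ∘ₗ LinearMap.inr A A Q)
    (LinearMap.ext fun p => key2 Ψ h1 p) (LinearMap.ext fun p => key Ψ h2 p)⟩

theorem cancel_all {R A : Type*} [CommRing R] [IsDomain R] (hP : IsPrufer R) (d : ℕ)
    (hdim : ringKrullDim R = d) [CommRing A] [Algebra R[X] A] (f : R[X]) (hf : f ≠ 0)
    [IsLocalization.Away f A] {P Q : Type*} [AddCommGroup P] [Module A P] [AddCommGroup Q] [Module A Q]
    (hG : Good R (A := A) P d) (t : ℕ) (Θ : (P × (Fin t → A)) ≃ₗ[A] (Q × (Fin t → A))) :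
    Nonempty (P ≃ₗ[A] Q) := by
  induction t with
  | zero => exact ⟨(LinearEquiv.prodUnique (R := A)).symm.trans (Θ.trans LinearEquiv.prodUnique)⟩
  | succ t ih =>
    have E : ∀ (M : Type _) [AddCommGroup M] [Module A M],
        Nonempty ((M × (Fin (t + 1) → A)) ≃ₗ[A] (A × (M × (Fin t → A)))) := fun M _ _ =>
      ⟨(LinearEquiv.prodCongr (LinearEquiv.refl A M) (Fin.consLinearEquiv A (fun _ => A)).symm).trans
        (LinearEquiv.prodAssoc A M A (Fin t → A)).symm |>.trans
        ((LinearEquiv.prodCongr (LinearEquiv.prodComm A M A) (LinearEquiv.refl A _)).trans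
        (LinearEquiv.prodAssoc A A M (Fin t → A)))⟩
    have E' : ∀ (M : Type _) [AddCommGroup M] [Module A M],
        Nonempty ((M × (Fin (t + 1) → A)) ≃ₗ[A] (A × (M × (Fin t → A)))) := fun M _ _ =>
      ⟨(LinearEquiv.prodCongr (LinearEquiv.refl A M) (Fin.consLinearEquiv A (fun _ => A)).symm).trans
        (LinearEquiv.prodAssoc A M A (Fin t → A)).symm |>.trans
        ((LinearEquiv.prodCongr (LinearEquiv.prodComm A M A) (LinearEquiv.refl A _)).trans
        (LinearEquiv.prodAssoc A A M (Fin t → A)))⟩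
    obtain ⟨E1⟩ := E P
    obtain ⟨E2⟩ := E' Q
    obtain ⟨Θ'⟩ := cancel_one hP d hdim f hf (hG.sum t) (E1.symm.trans (Θ.trans E2))
    exact ih Θ'

end P10

theorem good_of_rank {R A : Type*} [CommRing R] [IsDomain R] [CommRing A] [IsDomain A]
    [Algebra R[X] A] (f : R[X]) (hf : f ≠ 0) [IsLocalization.Away f A] {P : Type*}
    [AddCommGroup P] [Module A P] [Module.Finite A P] [Module.Projective A P] (d r : ℕ)
    (hr : max 2 (d + 1) ≤ r) (hrank : HasConstantRank A P r) : Good R (A := A) P d := by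
  have hr2 : 2 ≤ r := le_trans (le_max_left _ _) hr
  have hrd : d + 1 ≤ r := le_trans (le_max_right _ _) hr
  have hinj : Function.Injective (algebraMap R[X] A) :=
    IsLocalization.injective A (powers_le_nonZeroDivisors_of_noZeroDivisors hf)
  obtain ⟨n, s, hs, hc⟩ := generic_chart (R := R) (A := A) (P := P) f hf
  have hpc : ∀ p : Ideal A, p.IsPrime → ∃ δ ∉ p, Chart P (Fin r) δ := fun p hp =>
    prime_chart r p hp (hrank p hp).1 (hrank p hp).2
  obtain ⟨δ, hδ, hcδ⟩ := hpc ⊥ Ideal.isPrime_bot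
  have hσ : algebraMap R[X] A (C s) ≠ 0 := by
    rw [Ne, map_eq_zero_iff _ hinj, C_eq_zero]
    exact hs
  have hrn : r ≤ n := chart_le (fun h => hδ (by simp [h])) hσ hcδ hc
  refine ⟨⟨s, hs, Fin n, inferInstance, inferInstance, ?_, ?_, hc⟩, fun p hp => ?_⟩
  · simpa using hrd.trans hrn
  · simpa using hr2.trans hrn
  · obtain ⟨δ, hδ, hcδ⟩ := hpc p hp
    exact ⟨δ, hδ, Fin r, inferInstance, inferInstance, by simpa using hrd, by simpa using hr2, hcδ⟩

end Development

/-- Let `R` be a Prüfer domain (every nonzero finitely generated ideal is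
invertible) of finite Krull dimension `d`, let `f ∈ R[Y]` be nonzero, `A = R[Y][f⁻¹]`, and
`P` a finitely generated projective `A`-module of constant rank `r ≥ max {2, d+1}`.
Then `E(A ⊕ P)` acts transitively on `Um(A ⊕ P)`; in particular `P` is cancellative. -/
theorem statement_7 (R : Type*) [CommRing R] [IsDomain R]
    (hPrufer : ∀ I : Ideal R, I ≠ ⊥ → I.FG →
      ∃ J : FractionalIdeal (nonZeroDivisors R) (FractionRing R),
        (I : FractionalIdeal (nonZeroDivisors R) (FractionRing R)) * J = 1)
    (d : ℕ) (hdim : ringKrullDim R = d)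
    (f : R[X]) (hf : f ≠ 0)
    (P : Type*) [AddCommGroup P] [Module (Localization.Away f) P]
    [Module.Finite (Localization.Away f) P] [Module.Projective (Localization.Away f) P]
    (r : ℕ) (hr : max 2 (d + 1) ≤ r) (hrank : HasConstantRank (Localization.Away f) P r) :
    (∀ v w : Localization.Away f × P,
      IsUnimodular (Localization.Away f) (Localization.Away f × P) v →
      IsUnimodular (Localization.Away f) (Localization.Away f × P) w →
      ∃ σ ∈ TransvectionGroup (Localization.Away f) (Localization.Away f × P), σ v = w) ∧
    (∀ (Q : Type*) [AddCommGroup Q] [Module (Localization.Away f) Q],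
      Module.Finite (Localization.Away f) Q → Module.Projective (Localization.Away f) Q →
      ∀ t : ℕ,
        Nonempty ((P × (Fin t → Localization.Away f)) ≃ₗ[Localization.Away f]
          (Q × (Fin t → Localization.Away f))) →
        Nonempty (P ≃ₗ[Localization.Away f] Q)) := by
  have hdom : IsDomain (Localization.Away f) :=
    IsLocalization.isDomain_localization (powers_le_nonZeroDivisors_of_noZeroDivisors hf)
  have hG : Good R (A := Localization.Away f) P d := good_of_rank f hf d r hr hrank
  refine ⟨fun v w hv hw => ?_, fun Q _ _ _ _ t ht => ?_⟩
  · obtain ⟨τ, hτ, e⟩ := core hPrufer d hdim f hf hG v hv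
    obtain ⟨τ', hτ', e'⟩ := core hPrufer d hdim f hf hG w hw
    refine ⟨τ'⁻¹ * τ, mul_mem (inv_mem hτ') hτ, ?_⟩
    change τ'.symm (τ v) = w
    rw [e, ← e', LinearEquiv.symm_apply_apply]
  · exact cancel_all hPrufer d hdim f hf hG t ht.some
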